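/- Let k ≥ 0 and n̄ = (n_1,…,n_r) with r ≥ 1 and n_i ≥ 1 for all i, and set S := {i ∈ [r] : n_i = 1} and R := {i ∈ [r] : n_i ≥ 2}. If 0 ≤ k ≤ Σ_{i∈R} ⌊(n_i − 2)/2⌋ + max{0, ⌊(|S| − 1)/2⌋}, then every (k,n̄)-PPSN polytope has dimension at least 2k + |R| + 1. -/

import Mathlib

open Set

section PolytopeDefs

variable {E : Type*} [AddCommGroup E] [Module ℝ E]
variable {E' : Type*} [AddCommGroup E'] [Module ℝ E']

/-- A polytope: the convex hull of a finite set of points. -/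
def IsPolytope (P : Set E) : Prop :=
  ∃ V : Finset E, P = convexHull ℝ (V : Set E)

/-- The dimension of a set of points: the dimension of its affine span. -/
noncomputable def polyDim (P : Set E) : ℕ :=
  Module.finrank ℝ (affineSpan ℝ P).direction

/-- A nonempty exposed face of `P`: a nonempty set of the form
`{x ∈ P | ⟨c,x⟩ = max_{y ∈ P} ⟨c,y⟩}` for a linear functional `c`. -/
def IsFace (P F : Set E) : Prop :=
  F.Nonempty ∧ ∃ c : E →ₗ[ℝ] ℝ, F = {x ∈ P | ∀ y ∈ P, c y ≤ c x}

/-- The `k`-skeleton of `P`: its nonempty faces of dimension at most `k`. -/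
def skel (k : ℕ) (P : Set E) : Set (Set E) :=
  {F | IsFace P F ∧ polyDim F ≤ k}

/-- The set of all nonempty faces of `P`. -/
def facesOf (P : Set E) : Set (Set E) :=
  {F | IsFace P F}

/-- Combinatorial equivalence of `k`-skeletons: the posets of faces of dimension
at most `k`, ordered by inclusion, are order-isomorphic. -/
def SkelEquiv (k : ℕ) (P : Set E) (Q : Set E') : Prop :=
  Nonempty (skel k P ≃o skel k Q)

end PolytopeDefs

/-- The product of standard simplices `Δ_{n 0} × ⋯ × Δ_{n (r-1)}`. -/
def prodSimplex {r : ℕ} (n : Fin r → ℕ) : Set ((i : Fin r) → Fin (n i + 1) → ℝ) :=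
  Set.univ.pi fun i => stdSimplex ℝ (Fin (n i + 1))

/-- `P` is `(k, n̄)`-prodsimplicial-neighborly: it is a polytope whose `k`-skeleton
is combinatorially equivalent to that of the product of simplices `Δ_n̄`. -/
def IsPSN {E : Type*} [AddCommGroup E] [Module ℝ E] (k : ℕ) {r : ℕ} (n : Fin r → ℕ)
    (P : Set E) : Prop :=
  IsPolytope P ∧ SkelEquiv k P (prodSimplex n)

/-- `P` is `(k, n̄)`-projected-prodsimplicial-neighborly: it is `(k, n̄)`-PSN and moreover
the image under a linear map of a polytope whose poset of all nonempty faces is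
order-isomorphic to that of `Δ_n̄`. -/
def IsPPSN {E : Type*} [AddCommGroup E] [Module ℝ E] (k : ℕ) {r : ℕ} (n : Fin r → ℕ)
    (P : Set E) : Prop :=
  IsPSN k n P ∧ ∃ (N : ℕ) (Q : Set (Fin N → ℝ)) (f : (Fin N → ℝ) →ₗ[ℝ] E),
    IsPolytope Q ∧ P = f '' Q ∧ Nonempty (facesOf Q ≃o facesOf (prodSimplex n))

theorem Polynomial.Monic.exists_isRoot_of_odd_natDegree {p : Polynomial ℝ} (hp : p.Monic)
    (hodd : Odd p.natDegree) : ∃ c, p.IsRoot c := by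
  have hdeg : 0 < p.degree := Polynomial.natDegree_pos_iff_degree_pos.mp hodd.pos
  have htop := p.tendsto_atTop_of_leadingCoeff_nonneg hdeg (by simp [hp.leadingCoeff])
  have hnat : (p.comp (-Polynomial.X)).natDegree = p.natDegree := by
    simp [Polynomial.natDegree_comp]
  have hbot : Filter.Tendsto (fun x => p.eval x) Filter.atBot Filter.atBot := by
    have h := (p.comp (-Polynomial.X)).tendsto_atBot_of_leadingCoeff_nonpos
      (Polynomial.natDegree_pos_iff_degree_pos.mp (hnat ▸ hodd.pos))
      (by rw [Polynomial.leadingCoeff_comp (by simp)]; simp [hp.leadingCoeff, hodd.neg_one_pow])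
    simpa [Function.comp_def] using h.comp Filter.tendsto_neg_atBot_atTop
  exact (p.continuous.surjective htop hbot) 0

/-- On an odd-dimensional real vector space, a commutative ring of operators has a common
eigenvector. -/
theorem exists_common_eigenvector_of_odd_finrank {A M : Type*} [CommRing A] [Algebra ℝ A]
    [AddCommGroup M] [Module A M] [Module ℝ M] [IsScalarTower ℝ A M] (N : Submodule A M)
    [FiniteDimensional ℝ (N.restrictScalars ℝ)]
    (hN : Odd (Module.finrank ℝ (N.restrictScalars ℝ))) :
    ∃ v ∈ N, v ≠ 0 ∧ ∀ a : A, ∃ c : ℝ, a • v = c • v := by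
  induction hd : Module.finrank ℝ (N.restrictScalars ℝ) using Nat.strong_induction_on
    generalizing N with
  | _ d ih =>
  subst hd
  by_cases hsc : ∀ a : A, ∃ c : ℝ, ∀ v ∈ N, a • v = c • v
  · have : Nontrivial (N.restrictScalars ℝ) := Module.nontrivial_of_finrank_pos hN.pos
    obtain ⟨v, hv⟩ := exists_ne (0 : N.restrictScalars ℝ)
    refine ⟨v, v.2, by simpa using hv, fun a => ?_⟩
    obtain ⟨c, hc⟩ := hsc a
    exact ⟨c, hc _ v.2⟩
  push Not at hsc
  obtain ⟨a, ha⟩ := hsc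
  let T : Module.End ℝ (N.restrictScalars ℝ) :=
    { toFun := fun v => ⟨a • (v : M), N.smul_mem a v.2⟩
      map_add' := fun x y => by ext; simp
      map_smul' := fun c x => by
        ext
        simp only [Submodule.coe_smul, RingHom.id_apply]
        rw [← algebraMap_smul A c, ← algebraMap_smul A c, smul_smul, smul_smul, mul_comm] }
  obtain ⟨c, hc⟩ := T.charpoly_monic.exists_isRoot_of_odd_natDegree
    (by rwa [LinearMap.charpoly_natDegree])
  rw [← Module.End.hasEigenvalue_iff_isRoot_charpoly] at hc
  obtain ⟨w, hw⟩ := hc.exists_hasEigenvector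
  have hwa : a • (w : M) = c • (w : M) := congrArg Subtype.val hw.apply_eq_smul
  let b : A := a - algebraMap ℝ A c
  have hb : ∀ v : M, b • v = a • v - c • v := fun v => by simp [b, sub_smul]
  let L : M →ₗ[A] M := LinearMap.lsmul A M b
  let K : Submodule A M := N ⊓ LinearMap.ker L
  let I : Submodule A M := N.map L
  have hKN : K ≤ N := inf_le_left
  have hIN : I ≤ N := by
    rintro _ ⟨v, hv, rfl⟩
    exact N.smul_mem b hv
  have fdle : ∀ {J : Submodule A M}, J ≤ N → FiniteDimensional ℝ (J.restrictScalars ℝ) :=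
    fun {J} h => Submodule.finiteDimensional_of_le (S₂ := N.restrictScalars ℝ) h
  have := fdle hKN
  have := fdle hIN
  let g : N.restrictScalars ℝ →ₗ[ℝ] M := (L.restrictScalars ℝ) ∘ₗ (N.restrictScalars ℝ).subtype
  have hsum : Module.finrank ℝ (I.restrictScalars ℝ) + Module.finrank ℝ (K.restrictScalars ℝ)
      = Module.finrank ℝ (N.restrictScalars ℝ) := by
    have hr : I.restrictScalars ℝ = LinearMap.range g := by
      ext v
      simp [g, I, L]
    have hk : K.restrictScalars ℝ = (LinearMap.ker g).map (N.restrictScalars ℝ).subtype := by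
      ext v
      simp [g, K, L, and_comm]
    rw [← LinearMap.finrank_range_add_finrank_ker g, hr, hk,
      Submodule.finrank_map_subtype_eq]
  have hKpos : 0 < Module.finrank ℝ (K.restrictScalars ℝ) := by
    have hwK : (w : M) ∈ K.restrictScalars ℝ := by
      refine ⟨w.2, ?_⟩
      simp [L, hb, hwa]
    exact Module.finrank_pos_iff_exists_ne_zero.mpr
      ⟨⟨w, hwK⟩, fun h => hw.2 (Subtype.ext (by simpa using congrArg Subtype.val h))⟩
  have hIpos : 0 < Module.finrank ℝ (I.restrictScalars ℝ) := by
    obtain ⟨v, hv, hne⟩ := ha c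
    refine Module.finrank_pos_iff_exists_ne_zero.mpr ⟨⟨b • v, v, hv, rfl⟩, fun h => hne ?_⟩
    have h' : b • v = 0 := congrArg Subtype.val h
    rwa [hb, sub_eq_zero] at h'
  rcases Nat.even_or_odd (Module.finrank ℝ (K.restrictScalars ℝ)) with hK | hK
  · have hI : Odd (Module.finrank ℝ (I.restrictScalars ℝ)) := by
      rw [← hsum] at hN
      exact (Nat.odd_add.mp hN).mpr hK
    obtain ⟨v, hv, h⟩ := ih _ (by omega) I hI rfl
    exact ⟨v, hIN hv, h⟩
  · obtain ⟨v, hv, h⟩ := ih _ (by omega) K hK rfl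
    exact ⟨v, hKN hv, h⟩

/-- A perturbation `1 + s T` of the identity, with `T` locally finite, is bijective for all but
countably many `s`. -/
theorem countable_not_bijective_one_add_smul {E : Type*} [AddCommGroup E] [Module ℝ E]
    (T : Module.End ℝ E) (W : ℕ → Submodule ℝ E) [∀ e, FiniteDimensional ℝ (W e)]
    (hT : ∀ e, ∀ v ∈ W e, T v ∈ W e) (hW : ∀ v, ∃ e, v ∈ W e) :
    {s : ℝ | ¬ Function.Bijective (1 + s • T : Module.End ℝ E)}.Countable := by
  let R : ∀ e, Module.End ℝ (W e) := fun e => T.restrict (hT e)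
  have hsub : {s : ℝ | ¬ Function.Bijective (1 + s • T : Module.End ℝ E)} ⊆
      ⋃ e, (fun s : ℝ => -s⁻¹) ⁻¹' {μ | (R e).HasEigenvalue μ} := by
    intro s hs
    by_contra hne
    simp only [mem_iUnion, mem_preimage, mem_ofPred_eq, not_exists] at hne hs
    apply hs
    have hinj : ∀ v, (1 + s • T : Module.End ℝ E) v = 0 → v = 0 := by
      intro v hv
      obtain ⟨e, he⟩ := hW v
      by_contra hv0
      have hs0 : s ≠ 0 := by
        rintro rfl
        simp at hv
        exact hv0 hv
      refine hne e (Module.End.hasEigenvalue_of_hasEigenvector (x := ⟨v, he⟩)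
        ⟨Module.End.mem_eigenspace_iff.mpr ?_, by simpa using hv0⟩)
      ext
      simp only [LinearMap.add_apply, Module.End.one_apply, LinearMap.smul_apply] at hv
      have : s • T v = - v := by rw [eq_neg_iff_add_eq_zero, add_comm]; exact hv
      simp only [R, LinearMap.restrict_apply, Submodule.coe_smul]
      rw [neg_smul, ← smul_neg, ← this, smul_smul, inv_mul_cancel₀ hs0, one_smul]
    have hinj' : Function.Injective (1 + s • T : Module.End ℝ E) :=
      (injective_iff_map_eq_zero _).mpr hinj
    refine ⟨hinj', fun w => ?_⟩
    obtain ⟨e, he⟩ := hW w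
    have hm : ∀ v ∈ W e, (1 + s • T : Module.End ℝ E) v ∈ W e := fun v hv =>
      (W e).add_mem hv ((W e).smul_mem s (hT e v hv))
    have : Function.Injective ((1 + s • T : Module.End ℝ E).restrict hm) := by
      intro x y hxy
      exact Subtype.ext (hinj' (congrArg Subtype.val hxy))
    obtain ⟨x, hx⟩ := LinearMap.injective_iff_surjective.mp this ⟨w, he⟩
    exact ⟨x, congrArg Subtype.val hx⟩
  refine Countable.mono hsub (countable_iUnion fun e => ?_)
  exact ((R e).finite_hasEigenvalue.preimage
    (fun x _ y _ h => inv_injective (neg_injective h))).countable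

namespace MvPolynomial

theorem constr_basisMonomials_mem {σ E : Type*} [AddCommGroup E] [Module ℝ E]
    (t : (σ →₀ ℕ) → E) (p : MvPolynomial σ ℝ) (W : Submodule ℝ E) (h : ∀ u ∈ p.support, t u ∈ W) :
    (basisMonomials σ ℝ).constr ℝ t p ∈ W := by
  rw [Module.Basis.constr_apply]
  exact W.sum_mem fun u hu => W.smul_mem _ (h u hu)

theorem constr_basisMonomials_monomial {σ E : Type*} [AddCommGroup E] [Module ℝ E]
    (t : (σ →₀ ℕ) → E) (u : σ →₀ ℕ) :
    (basisMonomials σ ℝ).constr ℝ t (monomial u 1) = t u := by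
  rw [← (basisMonomials σ ℝ).constr_basis ℝ t u, coe_basisMonomials]

variable {n d : ℕ}

theorem exists_eq_add_single_of_le {u : Fin n →₀ ℕ} (h : ∃ i, d ≤ u i) :
    ∃ i m, u = m + Finsupp.single i d ∧ ∀ j < i, m j < d := by
  obtain ⟨i, hi, hmin⟩ := WellFounded.has_min (wellFounded_lt (α := Fin n)) {i | d ≤ u i} h
  refine ⟨i, u - Finsupp.single i d, ?_, fun j hj => ?_⟩
  · rw [tsub_add_cancel_of_le (Finsupp.single_le_iff.mpr hi)]
  · have : u j < d := not_le.mp fun h => hmin j h hj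
    simpa [Finsupp.single_apply, hj.ne'] using this

theorem add_single_inj_of_lt {m m' : Fin n →₀ ℕ} {i i' : Fin n}
    (h : m + Finsupp.single i d = m' + Finsupp.single i' d) (hm : ∀ j < i, m j < d)
    (hm' : ∀ j < i', m' j < d) : i = i' ∧ m = m' := by
  have hi : i = i' := by
    rcases lt_trichotomy i i' with hlt | heq | hlt
    · have h1 := hm' i hlt
      have h2 := DFunLike.congr_fun h i
      simp [hlt.ne'] at h2
      omega
    · exact heq
    · have h1 := hm i' hlt
      have h2 := DFunLike.congr_fun h i'
      simp [hlt.ne'] at h2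
      omega
  subst hi
  exact ⟨rfl, add_right_cancel h⟩

/-- Functions on monomials can be prescribed by cases: zero on monomials `u` with all exponents
below `d`, and arbitrary in terms of the least index `i` with `d ≤ u i` otherwise. -/
theorem exists_function_on_exponents {E : Type*} [Zero E] (n d : ℕ)
    (g : (Fin n →₀ ℕ) → Fin n → E) :
    ∃ t : (Fin n →₀ ℕ) → E, (∀ u, (∀ i, u i < d) → t u = 0) ∧
      ∀ m i, (∀ j < i, m j < d) → t (m + Finsupp.single i d) = g m i := by
  have : ∀ u : Fin n →₀ ℕ, ∃ y : E, ((∀ i, u i < d) → y = 0) ∧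
      ∀ m i, (∀ j < i, m j < d) → u = m + Finsupp.single i d → y = g m i := by
    intro u
    by_cases h : ∃ i, d ≤ u i
    · obtain ⟨i, m, rfl, hm⟩ := exists_eq_add_single_of_le h
      refine ⟨g m i, fun h' => ?_, fun m' i' hm' he => ?_⟩
      · obtain ⟨i', hi'⟩ := h
        exact absurd (h' i') (not_lt.mpr hi')
      · obtain ⟨rfl, rfl⟩ := add_single_inj_of_lt he hm hm'
        rfl
    · refine ⟨0, fun _ => rfl, fun m i _ he => absurd ⟨i, ?_⟩ h⟩
      simp [he]
  choose t ht0 ht using this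
  exact ⟨t, ht0, fun m i hm => ht _ m i hm rfl⟩

theorem totalDegree_monomial_mul_le {e : ℕ} {m : Fin n →₀ ℕ} {i : Fin n}
    (he : (m + Finsupp.single i d).degree ≤ e) {f : MvPolynomial (Fin n) ℝ}
    (hf : f.totalDegree ≤ d) : (monomial m (1 : ℝ) * f).totalDegree ≤ e := by
  refine (totalDegree_mul _ _).trans ?_
  have h1 : (monomial m (1 : ℝ)).totalDegree ≤ m.degree := totalDegree_monomial_le m 1
  have h2 : (m + Finsupp.single i d).degree = m.degree + d := by simp
  omega

theorem degree_le_of_mem_support {e : ℕ} {p : MvPolynomial (Fin n) ℝ} (hp : p.totalDegree ≤ e)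
    {u : Fin n →₀ ℕ} (hu : u ∈ p.support) : u.degree ≤ e :=
  (le_totalDegree hu).trans hp

theorem monomial_mul_perturbed (f : Fin n → MvPolynomial (Fin n) ℝ) (s : ℝ) (m : Fin n →₀ ℕ)
    (i : Fin n) : monomial m 1 * (X i ^ d + C s * f i)
      = monomial (m + Finsupp.single i d) 1 + s • (monomial m 1 * f i) := by
  rw [mul_add, X_pow_eq_monomial, monomial_mul, smul_eq_C_mul]
  ring_nf

/-- For all but countably many `s`, the quotient by the perturbed power system
`X_i ^ d + s f_i`, with `f_i` of degree at most `d`, has dimension `d ^ n`. -/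
theorem countable_not_quotient_equiv (f : Fin n → MvPolynomial (Fin n) ℝ)
    (hf : ∀ i, (f i).totalDegree ≤ d) :
    {s : ℝ | ¬ Nonempty ((MvPolynomial (Fin n) ℝ ⧸
      Ideal.span (range fun i => X i ^ d + C s * f i)) ≃ₗ[ℝ] ((Fin n → Fin d) → ℝ))}.Countable := by
  classical
  obtain ⟨t₁, ht₁, ht₁'⟩ := exists_function_on_exponents n d fun m i => monomial m (1 : ℝ) * f i
  let T₁ : Module.End ℝ (MvPolynomial (Fin n) ℝ) := (basisMonomials (Fin n) ℝ).constr ℝ t₁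
  have ht₂ : ∀ i : Fin n, ∃ t : (Fin n →₀ ℕ) → (Fin n → MvPolynomial (Fin n) ℝ),
      (∀ u, (∀ i, u i < d) → t u = 0) ∧ ∀ m j, (∀ l < j, m l < d) →
        t (m + Finsupp.single j d) = if j < i then
          (Pi.single (M := fun _ => MvPolynomial (Fin n) ℝ) j (monomial m (1 : ℝ) * f i) -
            Pi.single (M := fun _ => MvPolynomial (Fin n) ℝ) i (monomial m (1 : ℝ) * f j)) else 0 :=
    fun i => exists_function_on_exponents n d fun m j => if j < i then
          (Pi.single (M := fun _ => MvPolynomial (Fin n) ℝ) j (monomial m (1 : ℝ) * f i) -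
            Pi.single (M := fun _ => MvPolynomial (Fin n) ℝ) i (monomial m (1 : ℝ) * f j)) else 0
  choose t₂ ht₂ ht₂' using ht₂
  let T₂ : Module.End ℝ (Fin n → MvPolynomial (Fin n) ℝ) :=
    ∑ i, (basisMonomials (Fin n) ℝ).constr ℝ (t₂ i) ∘ₗ LinearMap.proj i
  let W : ℕ → Submodule ℝ (Fin n → MvPolynomial (Fin n) ℝ) := fun e =>
    Submodule.pi univ fun _ => restrictTotalDegree (Fin n) ℝ e
  have hWfin : ∀ e, FiniteDimensional ℝ (W e) := fun e => by
    let g : W e →ₗ[ℝ] (Fin n → restrictTotalDegree (Fin n) ℝ e) :=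
      LinearMap.pi fun i => (LinearMap.proj i ∘ₗ (W e).subtype).codRestrict _
        fun v => v.2 i (mem_univ i)
    refine Module.Finite.of_injective g fun v w hvw => ?_
    ext1
    funext i
    exact congrArg Subtype.val (congrFun hvw i)
  have h₁ := countable_not_bijective_one_add_smul T₁ (fun e => restrictTotalDegree (Fin n) ℝ e)
    (fun e v hv => by
      rw [mem_restrictTotalDegree] at hv
      refine constr_basisMonomials_mem _ _ _ fun u hu => ?_
      have hdeg := degree_le_of_mem_support hv hu
      by_cases h : ∃ i, d ≤ u i
      · obtain ⟨i, m, rfl, hm⟩ := exists_eq_add_single_of_le h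
        rw [ht₁' m i hm, mem_restrictTotalDegree]
        exact totalDegree_monomial_mul_le hdeg (hf i)
      · push Not at h
        rw [ht₁ u h]
        exact Submodule.zero_mem _)
    (fun v => ⟨v.totalDegree, by rw [mem_restrictTotalDegree]⟩)
  have h₂ := countable_not_bijective_one_add_smul T₂ W
    (fun e v hv => by
      have hv' : ∀ i, (v i).totalDegree ≤ e := fun i => by
        simpa [mem_restrictTotalDegree] using hv i (mem_univ i)
      simp only [T₂, LinearMap.sum_apply]
      refine Submodule.sum_mem _ fun i _ => ?_
      refine constr_basisMonomials_mem _ _ _ fun u hu => ?_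
      have hdeg := degree_le_of_mem_support (hv' i) hu
      have hsingle : ∀ j p, totalDegree p ≤ e →
          (Pi.single j p : Fin n → MvPolynomial (Fin n) ℝ) ∈ W e := by
        intro j p hp l _
        rw [SetLike.mem_coe, mem_restrictTotalDegree]
        by_cases hl : l = j
        · subst hl; simpa using hp
        · simp [hl]
      by_cases h : ∃ i, d ≤ u i
      · obtain ⟨j, m, rfl, hm⟩ := exists_eq_add_single_of_le h
        rw [ht₂' i m j hm]
        split_ifs
        · exact Submodule.sub_mem _ (hsingle _ _ (totalDegree_monomial_mul_le hdeg (hf i)))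
            (hsingle _ _ (totalDegree_monomial_mul_le hdeg (hf j)))
        · exact Submodule.zero_mem _
      · push Not at h
        rw [ht₂ i u h]
        exact Submodule.zero_mem _)
    (fun v => ⟨Finset.univ.sup fun i => (v i).totalDegree, fun i _ => by
      rw [SetLike.mem_coe, mem_restrictTotalDegree]
      exact Finset.le_sup (f := fun i => (v i).totalDegree) (Finset.mem_univ i)⟩)
  refine Countable.mono ?_ (h₁.union (h₂.preimage neg_injective))
  intro s hs
  by_contra hcon
  simp only [mem_union, mem_preimage, mem_ofPred_eq, not_or, not_not] at hcon hs
  obtain ⟨hb₁, hb₂⟩ := hcon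
  apply hs
  set F : Fin n → MvPolynomial (Fin n) ℝ := fun i => X i ^ d + C s * f i with hF
  let ρ : MvPolynomial (Fin n) ℝ →ₗ[ℝ] ((Fin n → Fin d) → ℝ) :=
    LinearMap.pi fun a => lcoeff ℝ (Finsupp.equivFunOnFinite.symm fun i => (a i : ℕ))
  have hρ : Function.Surjective ρ := by
    intro c
    refine ⟨∑ a, monomial (Finsupp.equivFunOnFinite.symm fun i => (a i : ℕ)) (c a), ?_⟩
    funext b
    have : ∀ a : Fin n → Fin d, (Finsupp.equivFunOnFinite.symm fun i => (a i : ℕ))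
        = (Finsupp.equivFunOnFinite.symm fun i => (b i : ℕ)) ↔ a = b := by
      intro a
      rw [Equiv.apply_eq_iff_eq]
      refine ⟨fun h => _root_.funext fun i => Fin.ext (congrFun h i), fun h => by rw [h]⟩
    simp [ρ, coeff_monomial, this]
  let Ψ := LinearEquiv.ofBijective _ hb₁
  have hΨ : ∀ p, Ψ p = p + s • T₁ p := fun p => rfl
  let q := ρ ∘ₗ Ψ.symm.toLinearMap
  have hq : Function.Surjective q := hρ.comp Ψ.symm.surjective
  have hgood : ∀ m i, (∀ j < i, m j < d) → q (monomial m 1 * F i) = 0 := by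
    intro m i hm
    have : monomial m 1 * F i = Ψ (monomial (m + Finsupp.single i d) 1) := by
      rw [hΨ, constr_basisMonomials_monomial, ht₁' m i hm, hF, monomial_mul_perturbed]
    simp only [q, LinearMap.comp_apply, this, LinearEquiv.coe_coe, LinearEquiv.symm_apply_apply]
    funext a
    have : m + Finsupp.single i d ≠ Finsupp.equivFunOnFinite.symm fun i => (a i : ℕ) := by
      intro h
      have h2 := DFunLike.congr_fun h i
      have h3 := (a i).2
      simp at h2
      omega
    simp [ρ, coeff_monomial, this]
  let φ : (Fin n → MvPolynomial (Fin n) ℝ) →ₗ[ℝ] MvPolynomial (Fin n) ℝ :=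
    ∑ i, LinearMap.mulRight ℝ (F i) ∘ₗ LinearMap.proj i
  have hφ : ∀ v, φ v = ∑ i, v i * F i := fun v => by simp [φ]
  have hφs : ∀ i p, φ (Pi.single i p) = p * F i := fun i p => by
    rw [hφ, Finset.sum_eq_single i]
    · simp
    · intro j _ hj; simp [hj]
    · simp
  have hzero : q ∘ₗ φ ∘ₗ (1 + (-s) • T₂) = 0 := by
    refine LinearMap.pi_ext' fun i => (basisMonomials (Fin n) ℝ).ext fun m => ?_
    have hT₂ : T₂ (Pi.single i (monomial m 1)) = t₂ i m := by
      simp only [T₂, LinearMap.sum_apply, LinearMap.comp_apply, LinearMap.proj_apply]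
      rw [Finset.sum_eq_single i]
      · rw [Pi.single_eq_same, constr_basisMonomials_monomial]
      · intro j _ hj; rw [Pi.single_eq_of_ne hj, map_zero]
      · simp
    simp only [coe_basisMonomials, LinearMap.comp_apply, LinearMap.single_apply,
      LinearMap.add_apply, Module.End.one_apply, LinearMap.smul_apply, hT₂, LinearMap.zero_apply]
    by_cases h : ∃ j, d ≤ m j
    · obtain ⟨j, m, rfl, hm⟩ := exists_eq_add_single_of_le h
      rw [ht₂' i m j hm]
      split_ifs with hji
      · rw [map_add, map_smul, map_sub, hφs, hφs, hφs]
        have key : monomial (m + Finsupp.single j d) 1 * F i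
            + -s • (monomial m 1 * f i * F j - monomial m 1 * f j * F i)
            = monomial (m + Finsupp.single i d) 1 * F j := by
          have e : ∀ l, monomial (m + Finsupp.single l d) (1 : ℝ) = monomial m 1 * X l ^ d :=
            fun l => by rw [X_pow_eq_monomial, monomial_mul, one_mul]
          rw [e, e, smul_eq_C_mul, C_neg, hF]
          ring
        rw [key]
        refine hgood _ _ fun l hl => ?_
        simpa [Finsupp.single_apply, (hl.trans hji).ne'] using hm l hl
      · rw [smul_zero, add_zero, hφs]
        refine hgood _ _ fun l hl => ?_
        have hlj := hl.trans_le (not_lt.mp hji)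
        simpa [Finsupp.single_apply, hlj.ne'] using hm l hlj
    · push Not at h
      rw [ht₂ i m h, smul_zero, add_zero, hφs]
      exact hgood _ _ fun l _ => h l
  have hqφ : ∀ v, q (φ v) = 0 := by
    intro v
    obtain ⟨w, rfl⟩ := hb₂.2 v
    exact LinearMap.congr_fun hzero w
  have hker : LinearMap.ker q = (Ideal.span (range F)).restrictScalars ℝ := by
    apply le_antisymm
    · intro v hv
      obtain ⟨w, rfl⟩ := Ψ.surjective v
      have hw : ρ w = 0 := by simpa [q] using hv
      have hΨw : Ψ w =
          (basisMonomials (Fin n) ℝ).constr ℝ (fun u => monomial u 1 + s • t₁ u) w := by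
        have : Ψ.toLinearMap
            = (basisMonomials (Fin n) ℝ).constr ℝ (fun u => monomial u 1 + s • t₁ u) := by
          refine (basisMonomials (Fin n) ℝ).ext fun u => ?_
          rw [Module.Basis.constr_basis, coe_basisMonomials, LinearEquiv.coe_coe, hΨ,
            constr_basisMonomials_monomial]
        rw [← this, LinearEquiv.coe_coe]
      rw [hΨw]
      refine constr_basisMonomials_mem _ _ _ fun u hu => ?_
      have h : ∃ i, d ≤ u i := by
        by_contra h
        push Not at h
        refine mem_support_iff.mp hu ?_
        have := congrFun hw fun i => ⟨u i, h i⟩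
        simpa [ρ] using this
      obtain ⟨i, m, rfl, hm⟩ := exists_eq_add_single_of_le h
      rw [ht₁' m i hm, ← monomial_mul_perturbed]
      exact Ideal.mul_mem_left _ _ (Ideal.subset_span ⟨i, rfl⟩)
    · intro v hv
      obtain ⟨c, rfl⟩ := (Ideal.mem_span_range_iff_exists_fun).mp hv
      rw [LinearMap.mem_ker, ← hφ, hqφ]
  exact ⟨(Submodule.Quotient.restrictScalarsEquiv ℝ (Ideal.span (range F))).symm ≪≫ₗ
    Submodule.quotEquivOfEq _ _ hker.symm ≪≫ₗ q.quotKerEquivOfSurjective hq⟩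

/-- For `d` odd and all but countably many `s`, the real system `ξ_i ^ d + s f_i(ξ) = 0` with
`f_i` of degree at most `d` is solvable. -/
theorem countable_not_exists_root_of_odd (f : Fin n → MvPolynomial (Fin n) ℝ)
    (hf : ∀ i, (f i).totalDegree ≤ d) (hd : Odd d) :
    {s : ℝ | ¬ ∃ ξ : Fin n → ℝ, ∀ i, ξ i ^ d + s * eval ξ (f i) = 0}.Countable := by
  refine Countable.mono (fun s hs => ?_) (countable_not_quotient_equiv f hf)
  rw [mem_ofPred_eq] at hs ⊢
  refine fun hne => hs ?_
  obtain ⟨ε⟩ := hne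
  set I := Ideal.span (range fun i => X i ^ d + C s * f i) with hI
  have hfd : FiniteDimensional ℝ (MvPolynomial (Fin n) ℝ ⧸ I) := ε.symm.finiteDimensional
  have hrank : Module.finrank ℝ (MvPolynomial (Fin n) ℝ ⧸ I) = d ^ n := by
    simp [ε.finrank_eq]
  obtain ⟨v, -, hv0, hv⟩ := exists_common_eigenvector_of_odd_finrank
    (⊤ : Submodule (MvPolynomial (Fin n) ℝ) (MvPolynomial (Fin n) ℝ ⧸ I))
    (by rw [Submodule.restrictScalars_top, finrank_top, hrank]; exact hd.pow)
  choose c hc using hv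
  let ξ : Fin n → ℝ := fun i => c (X i)
  have hsmul_v : ∀ p : MvPolynomial (Fin n) ℝ, p • v = eval ξ p • v := by
    intro p
    induction p using MvPolynomial.induction_on with
    | C a => rw [eval_C, ← algebraMap_eq, algebraMap_smul]
    | add p q hp hq => rw [add_smul, hp, hq, map_add, add_smul]
    | mul_X p i hp =>
      rw [mul_comm, mul_smul, hp, smul_comm, hc, map_mul, eval_X, smul_smul, mul_comm]
  refine ⟨ξ, fun i => ?_⟩
  have hzero : (X i ^ d + C s * f i : MvPolynomial (Fin n) ℝ) • v = 0 := by
    obtain ⟨w, rfl⟩ := Submodule.Quotient.mk_surjective _ v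
    rw [← Submodule.Quotient.mk_smul, Submodule.Quotient.mk_eq_zero]
    exact Ideal.mul_mem_right _ _ (Ideal.subset_span ⟨i, rfl⟩)
  rw [hsmul_v] at hzero
  simpa using (smul_eq_zero.mp hzero).resolve_right hv0

theorem exists_near_continuous {ι : Type*} {K : Set (ι → ℝ)} (hK : IsCompact K)
    {g : (ι → ℝ) → ℝ} (hg : Continuous g) {ε : ℝ} (hε : 0 < ε) :
    ∃ p : MvPolynomial ι ℝ, ∀ x ∈ K, |eval x p - g x| < ε := by
  let Φ : MvPolynomial ι ℝ →ₐ[ℝ] C(ι → ℝ, ℝ) := aeval fun i => ⟨fun x => x i, continuous_apply i⟩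
  have hΦ : ∀ p x, Φ p x = eval x p := by
    intro p x
    induction p using MvPolynomial.induction_on with
    | C a => simp [Φ]
    | add p q hp hq => rw [map_add, map_add, ContinuousMap.add_apply, hp, hq]
    | mul_X p i hp => rw [map_mul, map_mul, ContinuousMap.mul_apply, hp]; simp [Φ]
  have hsep : Φ.range.SeparatesPoints := by
    intro x y hxy
    obtain ⟨i, hi⟩ := Function.ne_iff.mp hxy
    refine ⟨fun z => z i, ⟨Φ (X i), ⟨X i, rfl⟩, ?_⟩, hi⟩
    funext z
    simp [hΦ]
  obtain ⟨_, ⟨p, rfl⟩, hp⟩ :=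
    ContinuousMap.exists_mem_subalgebra_near_continuous_of_isCompact_of_separatesPoints hsep
      ⟨g, hg⟩ hK hε
  exact ⟨p, fun x hx => by simpa [hΦ, Real.norm_eq_abs] using hp x hx⟩

/-- The odd part of a polynomial on the unit sphere, in the central chart
`ξ ↦ (1, ξ) / √(1 + |ξ|²)`. -/
theorem exists_eval_eq_odd_part {n d : ℕ} (hd : Odd d) (p : MvPolynomial (Fin (n + 1)) ℝ)
    (hp : p.totalDegree ≤ d) :
    ∃ q : MvPolynomial (Fin n) ℝ, q.totalDegree ≤ d ∧ ∀ (ξ : Fin n → ℝ) (ρ : ℝ), ρ ≠ 0 →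
      ρ ^ 2 = 1 + ∑ i, ξ i ^ 2 → eval ξ q = ρ ^ d *
        ((eval (ρ⁻¹ • (Fin.cons 1 ξ : Fin (n + 1) → ℝ)) p
          - eval (-(ρ⁻¹ • (Fin.cons 1 ξ : Fin (n + 1) → ℝ))) p) / 2) := by
  classical
  let v : Fin (n + 1) → MvPolynomial (Fin n) ℝ := Fin.cons 1 X
  have hv : ∀ i, (v i).totalDegree ≤ 1 := by
    intro i
    refine Fin.cases ?_ (fun i => ?_) i
    · simp [v]
    · simp [v]
  have hev : ∀ ξ i, eval ξ (v i) = (Fin.cons 1 ξ : Fin (n + 1) → ℝ) i := by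
    intro ξ i
    refine Fin.cases ?_ (fun i => ?_) i
    · simp [v]
    · simp [v]
  let w : MvPolynomial (Fin n) ℝ := 1 + ∑ i, X i ^ 2
  have hw : w.totalDegree ≤ 2 := by
    refine (totalDegree_add _ _).trans (max_le (by simp) (totalDegree_finsetSum_le fun i _ => ?_))
    simp
  refine ⟨∑ m ∈ p.support, if Odd m.degree then
    C (coeff m p) * ((∏ i, v i ^ m i) * w ^ ((d - m.degree) / 2)) else 0,
    totalDegree_finsetSum_le fun m hm => ?_, fun ξ ρ hρ hρ2 => ?_⟩
  · have hmd : m.degree ≤ d := degree_le_of_mem_support hp hm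
    split_ifs with ho
    · refine (totalDegree_mul _ _).trans ?_
      rw [totalDegree_C, zero_add]
      refine (totalDegree_mul _ _).trans ?_
      have h1 : (∏ i, v i ^ m i).totalDegree ≤ m.degree := by
        refine (totalDegree_finsetProd _ _).trans ?_
        rw [Finsupp.degree_eq_sum]
        refine Finset.sum_le_sum fun i _ => (totalDegree_pow _ _).trans ?_
        nlinarith [hv i]
      have h2 : (w ^ ((d - m.degree) / 2)).totalDegree ≤ ((d - m.degree) / 2) * 2 :=
        (totalDegree_pow _ _).trans (Nat.mul_le_mul_left _ hw)
      omega
    · simp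
  · rw [map_sum, eval_eq', eval_eq', ← Finset.sum_sub_distrib, Finset.sum_div, Finset.mul_sum]
    refine Finset.sum_congr rfl fun m hm => ?_
    have hmd : m.degree ≤ d := degree_le_of_mem_support hp hm
    have hew : eval ξ w = ρ ^ 2 := by simp [w, hρ2]
    have h1 : ∏ i, (ρ⁻¹ • (Fin.cons 1 ξ : Fin (n + 1) → ℝ)) i ^ m i
        = ρ⁻¹ ^ m.degree * ∏ i, (Fin.cons 1 ξ : Fin (n + 1) → ℝ) i ^ m i := by
      simp only [Pi.smul_apply, smul_eq_mul, mul_pow]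
      rw [Finset.prod_mul_distrib, Finset.prod_pow_eq_pow_sum, Finsupp.degree_eq_sum]
    have h2 : ∏ i, (-(ρ⁻¹ • (Fin.cons 1 ξ : Fin (n + 1) → ℝ))) i ^ m i
        = (-1) ^ m.degree * ∏ i, (ρ⁻¹ • (Fin.cons 1 ξ : Fin (n + 1) → ℝ)) i ^ m i := by
      rw [Finsupp.degree_eq_sum, ← Finset.prod_pow_eq_pow_sum, ← Finset.prod_mul_distrib]
      exact Finset.prod_congr rfl fun i _ => by rw [Pi.neg_apply, neg_pow]
    rw [h2, h1]
    split_ifs with ho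
    · rw [map_mul, map_mul, map_prod, eval_C, map_pow, hew, ho.neg_one_pow]
      simp only [map_pow, hev]
      have h3 : ρ ^ d = ρ ^ m.degree * (ρ ^ 2) ^ ((d - m.degree) / 2) := by
        rw [← pow_mul, ← pow_add]
        congr 1
        obtain ⟨a, ha⟩ := ho
        obtain ⟨b, hb⟩ := hd
        omega
      rw [h3, inv_pow]
      field_simp
      ring
    · rw [Nat.not_odd_iff_even] at ho
      rw [ho.neg_one_pow]
      simp

end MvPolynomial

/-- The **Borsuk–Ulam theorem**, in the form: `n` odd functions on `ℝⁿ⁺¹` have a common nontrivial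
zero. -/
theorem exists_ne_zero_of_odd {n : ℕ} (g : (Fin (n + 1) → ℝ) → Fin n → ℝ) (hg : Continuous g)
    (hodd : ∀ x, g (-x) = -g x) : ∃ x ≠ 0, g x = 0 := by
  let K : Set (Fin (n + 1) → ℝ) := {x | ∑ i, x i ^ 2 = 1}
  have hle : ∀ x ∈ K, ∀ i, |x i| ≤ 1 := by
    intro x hx i
    rw [← sq_le_one_iff_abs_le_one, ← show ∑ i, x i ^ 2 = 1 from hx]
    exact Finset.single_le_sum (f := fun i => x i ^ 2) (fun i _ => sq_nonneg _) (Finset.mem_univ i)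
  have hK : IsCompact K := by
    refine Metric.isCompact_of_isClosed_isBounded
      (isClosed_eq (by fun_prop) continuous_const) ?_
    refine (Metric.isBounded_closedBall (x := 0) (r := 1)).subset fun x hx => ?_
    rw [mem_closedBall_zero_iff, pi_norm_le_iff_of_nonneg zero_le_one]
    exact hle x hx
  have hneg : ∀ x ∈ K, -x ∈ K := fun x hx => by simpa [K] using hx
  have hK0 : ∀ x ∈ K, x ≠ 0 := by
    rintro x hx rfl
    simp [K] at hx
  have hKne : K.Nonempty := ⟨Pi.single 0 1, by
    have : ∀ i : Fin (n + 1), (Pi.single 0 1 : Fin (n + 1) → ℝ) i ^ 2 = if i = 0 then 1 else 0 :=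
      fun i => by by_cases h : i = 0 <;> simp [h]
    simp [K, this]⟩
  by_contra! hcon
  obtain ⟨x₀, hx₀, hmin⟩ := hK.exists_isMinOn hKne hg.norm.continuousOn
  set ε := ‖g x₀‖ with hε
  have hεpos : 0 < ε := norm_pos_iff.mpr (hcon x₀ (hK0 x₀ hx₀))
  choose p hp using fun i => MvPolynomial.exists_near_continuous hK
    ((continuous_apply i).comp hg) (half_pos hεpos)
  obtain ⟨d, hd, hpd⟩ : ∃ d, Odd d ∧ ∀ i, (p i).totalDegree ≤ d :=
    ⟨2 * (Finset.univ.sup fun i => (p i).totalDegree) + 1, ⟨_, rfl⟩, fun i => by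
      have := Finset.le_sup (f := fun i => (p i).totalDegree) (Finset.mem_univ i)
      omega⟩
  choose q hq hq' using fun i => MvPolynomial.exists_eval_eq_odd_part hd (p i) (hpd i)
  obtain ⟨s, hs, hsε⟩ := ((MvPolynomial.countable_not_exists_root_of_odd q hq hd).dense_compl
    ℝ).inter_open_nonempty _ (isOpen_Ioi (a := 2 / ε)) nonempty_Ioi
  obtain ⟨ξ, hξ⟩ := not_not.mp hsε
  have hs0 : 0 < s := (by positivity : 0 < 2 / ε).trans hs
  let ρ := √(1 + ∑ i, ξ i ^ 2)
  have hpos : 0 < 1 + ∑ i, ξ i ^ 2 := by positivity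
  have hρ : 0 < ρ := Real.sqrt_pos.mpr hpos
  have hρ2 : ρ ^ 2 = 1 + ∑ i, ξ i ^ 2 := Real.sq_sqrt hpos.le
  set u : Fin (n + 1) → ℝ := ρ⁻¹ • (Fin.cons 1 ξ : Fin (n + 1) → ℝ) with hu
  have huK : u ∈ K := by
    have : ∑ i, u i ^ 2 = ρ⁻¹ ^ 2 * ρ ^ 2 := by
      simp [hu, Fin.sum_univ_succ, mul_pow, hρ2, mul_add, Finset.mul_sum]
    rw [← mul_pow, inv_mul_cancel₀ hρ.ne', one_pow] at this
    exact this
  have hlt : ‖g u‖ < ε := by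
    rw [pi_norm_lt_iff hεpos]
    intro i
    have h1 := hξ i
    rw [hq' i ξ ρ hρ.ne' hρ2, ← hu] at h1
    have h2 : ξ i = ρ * u i.succ := by
      simp [hu, mul_inv_cancel_left₀ hρ.ne']
    set o := (MvPolynomial.eval u (p i) - MvPolynomial.eval (-u) (p i)) / 2 with ho
    have h3 : u i.succ ^ d + s * o = 0 := by
      have : ρ ^ d * (u i.succ ^ d + s * o) = 0 := by rw [← h1, h2]; ring
      exact (mul_eq_zero.mp this).resolve_left (pow_pos hρ d).ne'
    have h4 : s * |o| ≤ 1 := by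
      rw [← abs_of_pos hs0, ← abs_mul, ← neg_eq_of_add_eq_zero_right h3, abs_neg, abs_pow]
      exact pow_le_one₀ (abs_nonneg _) (hle u huK _)
    have h5 : |o| < ε / 2 := by
      have : 1 < s * (ε / 2) := by
        have := mem_Ioi.mp hs
        rw [div_lt_iff₀ hεpos] at this
        linarith
      exact lt_of_mul_lt_mul_left (h4.trans_lt this) hs0.le
    have h6 := hp i u huK
    have h7 := hp i (-u) (hneg u huK)
    simp only [Function.comp_apply, hodd, Pi.neg_apply] at h6 h7
    rw [abs_lt] at h5 h6 h7
    rw [Real.norm_eq_abs, abs_lt]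
    constructor <;> linarith
  exact absurd (hmin huK) (not_le.mpr hlt)

section LusternikSchnirelmann

variable {V : Type*} [NormedAddCommGroup V] [NormedSpace ℝ V] [FiniteDimensional ℝ V]

/-- At most `dim V` odd continuous functions on `V` are simultaneously nonpositive at some
nonzero point. -/
theorem exists_ne_zero_forall_nonpos_of_odd {ι : Type*} [Fintype ι]
    (hι : Fintype.card ι ≤ Module.finrank ℝ V) (hV : 0 < Module.finrank ℝ V) (f : ι → V → ℝ)
    (hf : ∀ i, Continuous (f i)) (hodd : ∀ i y, f i (-y) = -f i y) :
    ∃ y ≠ 0, ∀ i, f i y ≤ 0 := by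
  cases isEmpty_or_nonempty ι with
  | inl h =>
    have := Module.nontrivial_of_finrank_pos hV
    obtain ⟨y, hy⟩ := exists_ne (0 : V)
    exact ⟨y, hy, fun i => h.elim i⟩
  | inr h =>
    obtain ⟨m, hm⟩ : ∃ m, Fintype.card ι = m + 1 :=
      Nat.exists_eq_succ_of_ne_zero Fintype.card_ne_zero
    let e : Fin (m + 1) ≃ ι := (Fintype.equivFinOfCardEq hm).symm
    have hle : Module.finrank ℝ (Fin (m + 1) → ℝ) ≤ Module.finrank ℝ V := by
      rw [Module.finrank_fin_fun, ← hm]; exact hι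
    obtain ⟨L, hL⟩ : ∃ L : (Fin (m + 1) → ℝ) →ₗ[ℝ] V, Function.Injective L :=
      finrank_le_iff_exists_linearMap.mp hle
    have hLc : Continuous L := L.continuous_of_finiteDimensional
    obtain ⟨x, hx, hx0⟩ := exists_ne_zero_of_odd
      (fun x i => f (e i.succ) (L x) - f (e 0) (L x))
      (continuous_pi fun i => ((hf _).comp hLc).sub ((hf _).comp hLc))
      (fun x => by funext i; simp only [map_neg, hodd, Pi.neg_apply]; ring)
    have hne : L x ≠ 0 := fun h => hx (hL (by rw [h, map_zero]))
    have heq : ∀ i, f i (L x) = f (e 0) (L x) := by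
      intro i
      obtain ⟨j, rfl⟩ := e.surjective i
      refine Fin.cases rfl (fun j => ?_) j
      exact sub_eq_zero.mp (congrFun hx0 j)
    rcases le_total (f (e 0) (L x)) 0 with h0 | h0
    · exact ⟨L x, hne, fun i => (heq i).trans_le h0⟩
    · exact ⟨-L x, neg_ne_zero.mpr hne, fun i => by rw [hodd, heq]; linarith⟩

/-- Given `2κ + m` linear forms with `m > 0`, there are `m` odd continuous functions whose
nonpositivity forces at most `κ` of the linear forms to be positive. -/
theorem exists_odd_card_pos_le {ι : Type*} [Fintype ι] (b : ι → V →ₗ[ℝ] ℝ) {κ m : ℕ}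
    (hm : 0 < m) (hι : Fintype.card ι = 2 * κ + m) :
    ∃ f : Fin m → V → ℝ, (∀ l, Continuous (f l)) ∧
      (∀ l y, f l (-y) = -f l y) ∧
      ∀ y, (∀ l, f l y ≤ 0) → (Finset.univ.filter fun j => 0 < b j y).card ≤ κ := by
  classical
  obtain ⟨M, -, hM⟩ := Finset.exists_subset_card_eq (s := (Finset.univ : Finset ι))
    (show 2 * κ + 1 ≤ Fintype.card ι by omega)
  have hbc : ∀ j, Continuous (b j) := fun j => (b j).continuous_of_finiteDimensional
  let h : V → ℝ := fun y => ∑ T ∈ M.powersetCard (κ + 1), ∏ j ∈ T, max (b j y) 0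
  have hterm : ∀ y T, 0 ≤ ∏ j ∈ T, max (b j y) 0 :=
    fun y T => Finset.prod_nonneg fun _ _ => le_max_right _ _
  have hc : Continuous h := by fun_prop
  have hpos : ∀ y, κ + 1 ≤ (M.filter fun j => 0 < b j y).card → 0 < h y := by
    intro y hy
    obtain ⟨T, hT, hTc⟩ := Finset.exists_subset_card_eq hy
    refine Finset.sum_pos' (fun T _ => hterm y T) ⟨T, ?_, Finset.prod_pos fun j hj => ?_⟩
    · exact Finset.mem_powersetCard.mpr ⟨hT.trans (Finset.filter_subset _ _), hTc⟩
    · exact lt_max_of_lt_left (Finset.mem_filter.mp (hT hj)).2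
  have hzero : ∀ y, (M.filter fun j => 0 < b j y).card ≤ κ → h y = 0 := by
    intro y hy
    refine Finset.sum_eq_zero fun T hT => ?_
    obtain ⟨hTM, hTc⟩ := Finset.mem_powersetCard.mp hT
    obtain ⟨j, hj, hj'⟩ : ∃ j ∈ T, ¬ 0 < b j y := by
      by_contra! hcon
      have := Finset.card_le_card
        (fun j hj => Finset.mem_filter.mpr ⟨hTM hj, hcon j hj⟩ : T ⊆ M.filter fun j => 0 < b j y)
      omega
    exact Finset.prod_eq_zero hj (max_eq_right (not_lt.mp hj'))
  have hcard : Fintype.card (Option {j // j ∉ M}) = m := by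
    have := Fintype.card_subtype_compl (· ∈ M)
    rw [Fintype.card_option, this, Fintype.card_coe, hM]
    omega
  let e := (Fintype.equivFinOfCardEq hcard).symm
  let F : Option {j // j ∉ M} → V → ℝ := fun o y => o.elim (h y - h (-y)) fun j => b j y
  have hFc : ∀ o, Continuous (F o)
    | none => hc.sub (hc.comp continuous_neg)
    | some j => hbc j
  have hFodd : ∀ o y, F o (-y) = -F o y
    | none, y => by simp [F]
    | some j, y => by simp [F]
  refine ⟨fun l => F (e l), fun l => hFc _, fun l => hFodd _, fun y hy => ?_⟩
  · have hF : ∀ o, F o y ≤ 0 := fun o => by simpa using hy (e.symm o)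
    have h1 : (Finset.univ.filter fun j => 0 < b j y) = M.filter fun j => 0 < b j y := by
      ext j
      simp only [Finset.mem_filter, Finset.mem_univ, true_and]
      refine ⟨fun hj => ⟨?_, hj⟩, fun hj => hj.2⟩
      by_contra hjM
      exact absurd hj (not_lt.mpr (hF (some ⟨j, hjM⟩)))
    rw [h1]
    by_contra! hlt
    have h2 : h (-y) = 0 := by
      refine hzero _ ?_
      have hdisj : Disjoint (M.filter fun j => 0 < b j y) (M.filter fun j => 0 < b j (-y)) := by
        rw [Finset.disjoint_filter]
        intro j _ hj hj'
        rw [map_neg] at hj'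
        linarith
      have := Finset.card_le_card (Finset.union_subset (Finset.filter_subset
        (fun j => 0 < b j y) M) (Finset.filter_subset (fun j => 0 < b j (-y)) M))
      rw [Finset.card_union_of_disjoint hdisj] at this
      omega
    have h3 : h y - h (-y) ≤ 0 := hF none
    have h4 := hpos y hlt
    linarith

theorem Finset.exists_le_sum_eq {ι : Type*} (s : Finset ι) (c : ι → ℕ) {k : ℕ}
    (hk : k ≤ ∑ i ∈ s, c i) : ∃ κ : ι → ℕ, (∀ i, κ i ≤ c i) ∧ ∑ i ∈ s, κ i = k := by
  classical
  induction s using Finset.induction_on generalizing k with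
  | empty => exact ⟨0, fun i => Nat.zero_le _, by simpa using (Nat.le_zero.mp hk).symm⟩
  | insert j s hj ih =>
    rw [Finset.sum_insert hj] at hk
    obtain ⟨κ, hκ, hsum⟩ := ih (k := k - min k (c j)) (by omega)
    refine ⟨Function.update κ j (min k (c j)), fun i => ?_, ?_⟩
    · by_cases h : i = j
      · subst h; simp
      · simpa [h] using hκ i
    · rw [Finset.sum_insert hj, Function.update_self, Finset.sum_congr rfl fun i hi =>
        Function.update_of_ne (ne_of_mem_of_not_mem hi hj) _ _, hsum]
      omega

/-- On a large enough space, a family of linear forms indexed like the facets of a product of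
simplices has few positive members at some nonzero point. -/
theorem exists_ne_zero_sum_card_pos_sub_one_le {k r : ℕ} (hr : 1 ≤ r) {n : Fin r → ℕ}
    (hn : ∀ i, 1 ≤ n i)
    (hk : k ≤ (∑ i ∈ Finset.univ.filter (fun i : Fin r => 2 ≤ n i), (n i - 2) / 2)
        + ((Finset.univ.filter (fun i : Fin r => n i = 1)).card - 1) / 2)
    (a : ∀ i, Fin (n i + 1) → V →ₗ[ℝ] ℝ)
    (hV : ∑ i, n i ≤ Module.finrank ℝ V + 2 * k
      + (Finset.univ.filter (fun i : Fin r => 2 ≤ n i)).card) :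
    ∃ y ≠ 0, ∑ i, ((Finset.univ.filter fun j => 0 < a i j y).card - 1) ≤ k := by
  classical
  set R := Finset.univ.filter (fun i : Fin r => 2 ≤ n i) with hR
  set S := Finset.univ.filter (fun i : Fin r => n i = 1) with hS
  have hRmem : ∀ i, i ∈ R ↔ 2 ≤ n i := fun i => by simp [hR]
  have hSmem : ∀ i, i ∈ S ↔ n i = 1 := fun i => by simp [hS]
  have hdisj : Disjoint R S := by
    rw [Finset.disjoint_left]
    intro i hi hi'
    rw [hRmem] at hi
    rw [hSmem] at hi'
    omega
  have hunion : R ∪ S = Finset.univ := by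
    ext i
    have := hn i
    simp only [Finset.mem_union, hRmem, hSmem, Finset.mem_univ, iff_true]
    omega
  set kS := min k ((S.card - 1) / 2) with hkS
  obtain ⟨κ, hκ, hκsum⟩ := Finset.exists_le_sum_eq R (fun i => (n i - 2) / 2) (k := k - kS)
    (by omega)
  have hκ' : ∀ i ∈ R, 2 * κ i + 2 ≤ n i := fun i hi => by
    have h1 := (hRmem i).mp hi
    have h2 := hκ i
    omega
  obtain ⟨f, hf, hfodd, hfcard⟩ : ∃ f : (i : R) → Fin (n i + 1 - 2 * (κ i + 1)) → V → ℝ,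
      (∀ i l, Continuous (f i l)) ∧ (∀ i l y, f i l (-y) = -f i l y) ∧ ∀ (i : R) y,
        (∀ l, f i l y ≤ 0) → (Finset.univ.filter fun j => 0 < a i j y).card ≤ κ i + 1 := by
    have := fun i : R => exists_odd_card_pos_le (a i) (κ := κ i + 1)
      (m := n i + 1 - 2 * (κ i + 1)) (by have := hκ' i i.2; omega)
      (by have := hκ' i i.2; rw [Fintype.card_fin]; omega)
    choose f hf hfodd hfcard using this
    exact ⟨f, hf, hfodd, hfcard⟩
  obtain ⟨g, hg, hgodd, hgcard⟩ : ∃ g : Fin (S.card - 2 * kS) → V → ℝ,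
      (∀ l, Continuous (g l)) ∧ (∀ l y, g l (-y) = -g l y) ∧ ∀ y, (∀ l, g l y ≤ 0) →
        (S.filter fun i => 0 < ∑ j, a i j y).card ≤ kS := by
    rcases S.eq_empty_or_nonempty with hS0 | hS0
    · rw [hS0]
      exact ⟨fun _ _ => 0, fun _ => continuous_const, fun _ _ => by simp, by simp⟩
    · have hpos := hS0.card_pos
      obtain ⟨g, hg, hgodd, hgcard⟩ := exists_odd_card_pos_le (fun i : S => ∑ j, a i j)
        (κ := kS) (m := S.card - 2 * kS) (by omega) (by rw [Fintype.card_coe]; omega)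
      refine ⟨g, hg, hgodd, fun y hy => le_trans (le_of_eq ?_) (hgcard y hy)⟩
      rw [← Finset.card_map (Function.Embedding.subtype _)]
      congr 1
      ext i
      simp only [Finset.mem_filter, Finset.mem_map, Finset.mem_univ, true_and, LinearMap.sum_apply]
      exact ⟨fun h => ⟨⟨i, h.1⟩, h.2, rfl⟩, by rintro ⟨x, hx, rfl⟩; exact ⟨x.2, hx⟩⟩
  have hsumR : ∑ i ∈ R, (n i + 1 - 2 * (κ i + 1)) + (R.card + 2 * (k - kS)) = ∑ i ∈ R, n i := by
    rw [← hκsum, Finset.mul_sum, Finset.card_eq_sum_ones, ← Finset.sum_add_distrib,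
      ← Finset.sum_add_distrib]
    refine Finset.sum_congr rfl fun i hi => ?_
    have := hκ' i hi
    omega
  have hsumS : ∑ i ∈ S, n i = S.card := by
    rw [Finset.card_eq_sum_ones]
    exact Finset.sum_congr rfl fun i hi => (hSmem i).mp hi
  have hsum : ∑ i, n i = ∑ i ∈ R, n i + S.card := by
    rw [← hunion, Finset.sum_union hdisj, hsumS]
  have hcard : Fintype.card ((Σ i : R, Fin (n i + 1 - 2 * (κ i + 1))) ⊕ Fin (S.card - 2 * kS))
      = ∑ i ∈ R, (n i + 1 - 2 * (κ i + 1)) + (S.card - 2 * kS) := by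
    simp only [Fintype.card_sum, Fintype.card_sigma, Fintype.card_fin]
    rw [Finset.sum_coe_sort R fun i => n i + 1 - 2 * (κ i + 1)]
  have hpos : 0 < ∑ i ∈ R, (n i + 1 - 2 * (κ i + 1)) + (S.card - 2 * kS) := by
    have h0 : (⟨0, hr⟩ : Fin r) ∈ R ∪ S := hunion ▸ Finset.mem_univ _
    rcases Finset.mem_union.mp h0 with h0 | h0
    · have h1 := Finset.single_le_sum (f := fun i => n i + 1 - 2 * (κ i + 1))
        (fun _ _ => Nat.zero_le _) h0
      have h2 := hκ' _ h0
      omega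
    · have := Finset.card_pos.mpr ⟨_, h0⟩
      omega
  have hle : ∑ i ∈ R, (n i + 1 - 2 * (κ i + 1)) + (S.card - 2 * kS) ≤ Module.finrank ℝ V := by
    rcases S.eq_empty_or_nonempty with hS0 | hS0
    · have : S.card = 0 := by rw [hS0]; rfl
      omega
    · have := hS0.card_pos
      omega
  obtain ⟨y, hy0, hy⟩ := exists_ne_zero_forall_nonpos_of_odd (hcard.trans_le hle)
    (hpos.trans_le hle) (Sum.elim (fun p => f p.1 p.2) g)
    (by rintro (p | l); exacts [hf _ _, hg _])
    (by rintro (p | l) y; exacts [hfodd _ _ _, hgodd _ _])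
  refine ⟨y, hy0, ?_⟩
  rw [← hunion, Finset.sum_union hdisj]
  have h1 : ∑ i ∈ R, ((Finset.univ.filter fun j => 0 < a i j y).card - 1) ≤ ∑ i ∈ R, κ i :=
    Finset.sum_le_sum fun i hi => Nat.sub_le_of_le_add
      (hfcard ⟨i, hi⟩ y fun l => hy (Sum.inl ⟨⟨i, hi⟩, l⟩))
  have h2 : ∑ i ∈ S, ((Finset.univ.filter fun j => 0 < a i j y).card - 1)
      ≤ (S.filter fun i => 0 < ∑ j, a i j y).card := by
    rw [Finset.card_filter]
    refine Finset.sum_le_sum fun i hi => ?_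
    have hni := (hSmem i).mp hi
    by_cases hall : ∀ j, 0 < a i j y
    · rw [if_pos (Finset.sum_pos (fun j _ => hall j) Finset.univ_nonempty)]
      have := Finset.card_filter_le (Finset.univ : Finset (Fin (n i + 1))) fun j => 0 < a i j y
      rw [Finset.card_univ, Fintype.card_fin] at this
      omega
    · push Not at hall
      obtain ⟨j, hj⟩ := hall
      have := Finset.card_lt_card (Finset.filter_ssubset.mpr
        ⟨j, Finset.mem_univ _, not_lt.mpr hj⟩ :
          (Finset.univ.filter fun j => 0 < a i j y) ⊂ Finset.univ)
      rw [Finset.card_univ, Fintype.card_fin] at this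
      omega
  have h3 := hgcard y fun l => hy (Sum.inr l)
  omega

end LusternikSchnirelmann

/-- Tuples of nonempty sets of vertices: the combinatorial faces of a product of simplices with
vertex sets `α i`. -/
abbrev FaceTuple {ι : Type*} (α : ι → Type*) : Type _ :=
  {A : ∀ i, Finset (α i) // ∀ i, (A i).Nonempty}

namespace FaceTuple

variable {ι : Type*} {α : ι → Type*}

/-- The dimension of the face of a product of simplices encoded by a tuple. -/
def rank [Fintype ι] (A : FaceTuple α) : ℕ := ∑ i, ((A.1 i).card - 1)

/-- The vertex `v` of a product of simplices. -/
def vertex (v : ∀ i, α i) : FaceTuple α := ⟨fun i => {v i}, fun _ => Finset.singleton_nonempty _⟩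

@[simp]
theorem vertex_le {v : ∀ i, α i} {A : FaceTuple α} : vertex v ≤ A ↔ ∀ i, v i ∈ A.1 i := by
  refine forall_congr' fun i => ?_
  simp [vertex]

@[simp]
theorem rank_vertex [Fintype ι] (v : ∀ i, α i) : (vertex v).rank = 0 := by
  simp [rank, vertex]

theorem vertex_injective : Function.Injective (vertex : (∀ i, α i) → FaceTuple α) := by
  intro v w h
  funext i
  have : v i ∈ (vertex w).1 i := vertex_le.mp h.le i
  simpa [vertex] using this

theorem exists_vertex_le (A : FaceTuple α) : ∃ v, vertex v ≤ A :=
  ⟨fun i => (A.2 i).choose, vertex_le.mpr fun i => (A.2 i).choose_spec⟩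

theorem le_vertex {A : FaceTuple α} {v : ∀ i, α i} (h : A ≤ vertex v) : A = vertex v := by
  obtain ⟨w, hw⟩ := A.exists_vertex_le
  refine le_antisymm h ?_
  have : w = v := by
    funext i
    simpa [vertex] using vertex_le.mp (hw.trans h) i
  rwa [← this]

theorem update_le [DecidableEq ι] {A : FaceTuple α} {v : ∀ i, α i} (hv : vertex v ≤ A) {i : ι}
    {x : α i} (hx : x ∈ A.1 i) : vertex (Function.update v i x) ≤ A := by
  rw [vertex_le] at hv ⊢
  intro j
  by_cases h : j = i
  · subst h; simpa using hx
  · simpa [h] using hv j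

theorem exists_vertex_le_mem {A : FaceTuple α} {i : ι} {x : α i} (hx : x ∈ A.1 i) :
    ∃ v, vertex v ≤ A ∧ v i = x := by
  classical
  obtain ⟨v, hv⟩ := A.exists_vertex_le
  exact ⟨_, update_le hv hx, Function.update_self ..⟩

theorem le_of_forall_vertex {A B : FaceTuple α} (h : ∀ v, vertex v ≤ A → vertex v ≤ B) :
    A ≤ B := by
  intro i x hx
  obtain ⟨v, hv, rfl⟩ := exists_vertex_le_mem hx
  exact vertex_le.mp (h v hv) i

/-- Vertices joined by an edge. -/
def Adj (v w : ∀ i, α i) : Prop := v ≠ w ∧ ∃ i, ∀ j, j ≠ i → w j = v j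

theorem adj_of_forall_vertex_le {A : FaceTuple α} {v w : ∀ i, α i} (hv : vertex v ≤ A)
    (hw : vertex w ≤ A) (hvw : v ≠ w) (h : ∀ u, vertex u ≤ A → u = v ∨ u = w) : Adj v w := by
  classical
  obtain ⟨i, hi⟩ := Function.ne_iff.mp hvw
  refine ⟨hvw, i, fun j hj => ?_⟩
  have hne : Function.update v i (w i) ≠ v := fun h => hi (by rw [← h, Function.update_self])
  rw [← (h _ (update_le hv (vertex_le.mp hw i))).resolve_left hne, Function.update_of_ne hj]

theorem Adj.exists_edge [Fintype ι] {v w : ∀ i, α i} (h : Adj v w) : ∃ A : FaceTuple α, A.rank ≤ 1 ∧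
    vertex v ≤ A ∧ vertex w ≤ A ∧ ∀ u, vertex u ≤ A → u = v ∨ u = w := by
  classical
  obtain ⟨-, i, hi⟩ := h
  refine ⟨⟨fun j => {v j, w j}, fun j => by simp⟩, ?_, ?_, ?_, fun u hu => ?_⟩
  · rw [rank, Finset.sum_eq_single i]
    · exact Nat.sub_le_of_le_add (Finset.card_le_two)
    · intro j _ hj; simp [hi j hj]
    · simp
  · rw [vertex_le]; simp
  · rw [vertex_le]; simp
  · rw [vertex_le] at hu
    have hu' : ∀ j, u j = v j ∨ u j = w j := fun j => by simpa using hu j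
    refine (hu' i).imp (fun h => funext fun j => ?_) fun h => funext fun j => ?_
    · by_cases hj : j = i
      · subst hj; exact h
      · simpa [hi j hj] using hu' j
    · by_cases hj : j = i
      · subst hj; exact h
      · simpa [hi j hj] using hu' j

theorem rank_eq_ncard_adj [Fintype ι] {A : FaceTuple α} {v : ∀ i, α i} (hv : vertex v ≤ A) :
    A.rank = {w | vertex w ≤ A ∧ Adj v w}.ncard := by
  classical
  rw [vertex_le] at hv
  have h1 : {w | vertex w ≤ A ∧ Adj v w} =
      (Finset.univ.sigma fun i => (A.1 i).erase (v i)).image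
        fun p => Function.update v p.1 p.2 := by
    ext w
    simp only [mem_ofPred_eq, Finset.coe_image, mem_image, Finset.mem_coe, Finset.mem_sigma,
      Finset.mem_univ, true_and, Finset.mem_erase]
    constructor
    · rintro ⟨hw, hne, i, hi⟩
      have hwi : w = Function.update v i (w i) := Function.eq_update_iff.mpr ⟨rfl, hi⟩
      refine ⟨⟨i, w i⟩, ⟨fun h => hne ?_, vertex_le.mp hw i⟩, hwi.symm⟩
      simp only at h
      rw [hwi, h, Function.update_eq_self]
    · rintro ⟨⟨i, x⟩, ⟨hx, hxA⟩, rfl⟩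
      refine ⟨update_le (vertex_le.mpr hv) hxA, fun h => hx ?_, i, fun j hj => ?_⟩
      · simpa using (congrFun h i).symm
      · exact Function.update_of_ne hj _ _
  rw [h1, ncard_coe_finset, Finset.card_image_of_injOn, Finset.card_sigma]
  · exact Finset.sum_congr rfl fun i _ => (Finset.card_erase_of_mem (hv i)).symm
  · rintro ⟨i, x⟩ hx ⟨j, y⟩ hy hxy
    simp only [Finset.coe_sigma, mem_sigma_iff, Finset.mem_coe, Finset.mem_erase] at hx hy hxy
    have hij : i = j := by
      by_contra hij
      have := congrFun hxy i
      rw [Function.update_self, Function.update_of_ne hij] at this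
      exact hx.2.1 this
    subst hij
    simpa using congrFun hxy i

theorem exists_covBy_rank [Fintype ι] {A B : FaceTuple α} (h : A < B) :
    ∃ C, A ≤ C ∧ C < B ∧ B.rank = C.rank + 1 := by
  classical
  obtain ⟨i, hi⟩ : ∃ i, ¬ B.1 i ⊆ A.1 i := by
    by_contra! hcon
    exact h.not_ge hcon
  obtain ⟨x, hxB, hxA⟩ := Finset.not_subset.mp hi
  have hle : A.1 ≤ Function.update B.1 i ((B.1 i).erase x) := by
    intro j
    by_cases hj : j = i
    · subst hj
      rw [Function.update_self]
      exact Finset.subset_erase.mpr ⟨h.le j, hxA⟩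
    · rw [Function.update_of_ne hj]
      exact h.le j
  have hC : Function.update B.1 i ((B.1 i).erase x) < B.1 :=
    update_lt_self_iff.mpr (Finset.erase_ssubset hxB)
  refine ⟨⟨_, fun j => (A.2 j).mono (hle j)⟩, hle, hC, ?_⟩
  have hpos : 1 ≤ ((B.1 i).erase x).card := by
    have := ((A.2 i).mono (hle i)).card_pos
    rwa [Function.update_self] at this
  have hcard := Finset.card_erase_add_one hxB
  have hsum : ∑ j ∈ Finset.univ.erase i, ((Function.update B.1 i ((B.1 i).erase x) j).card - 1)
      = ∑ j ∈ Finset.univ.erase i, ((B.1 j).card - 1) :=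
    Finset.sum_congr rfl fun j hj => by rw [Function.update_of_ne (Finset.ne_of_mem_erase hj)]
  rw [rank, rank, ← Finset.add_sum_erase _ _ (Finset.mem_univ i),
    ← Finset.add_sum_erase _ (fun j => (Function.update B.1 i ((B.1 i).erase x) j).card - 1)
      (Finset.mem_univ i), Function.update_self, hsum]
  omega

theorem rank_mono [Fintype ι] {A B : FaceTuple α} (h : A ≤ B) : A.rank ≤ B.rank :=
  Finset.sum_le_sum fun i _ => Nat.sub_le_sub_right (Finset.card_le_card (h i)) 1

theorem add_rank_le_of_strictMono [Fintype ι] {D : FaceTuple α → ℕ} (hD : StrictMono D)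
    {A B : FaceTuple α} (h : A ≤ B) : D A + B.rank ≤ D B + A.rank := by
  induction hm : B.rank generalizing B with
  | zero => exact (hD.monotone h).trans (Nat.le_add_right _ _)
  | succ m ih =>
    rcases h.eq_or_lt with rfl | hlt
    · rw [hm]
    · obtain ⟨C, hAC, hCB, hr⟩ := exists_covBy_rank hlt
      have h1 := ih hAC (by omega)
      have h2 := hD hCB
      omega

/-- An order embedding of the `k`-skeleton of a product of simplices in its face poset which
preserves disjointness is onto the `k`-skeleton. -/
theorem exists_eq_of_rank_le [Fintype ι] [∀ i, Finite (α i)] {k : ℕ}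
    (θ : {A : FaceTuple α // A.rank ≤ k} → FaceTuple α)
    (hθ : ∀ A B, θ A ≤ θ B ↔ A ≤ B)
    (hdisj : ∀ A B C, C ≤ θ A → C ≤ θ B → ∃ D, D ≤ A ∧ D ≤ B)
    {B : FaceTuple α} (hB : B.rank ≤ k) : ∃ A, θ A = B := by
  classical
  have hfin : ∀ i, Fintype (α i) := fun i => Fintype.ofFinite _
  let at' : (∀ i, α i) → {A : FaceTuple α // A.rank ≤ k} := fun v => ⟨vertex v, by simp⟩
  choose w hw using fun v => (θ (at' v)).exists_vertex_le
  have huniq : ∀ u v v', vertex u ≤ θ (at' v) → vertex u ≤ θ (at' v') → v = v' := by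
    intro u v v' h h'
    obtain ⟨D, hD, hD'⟩ := hdisj _ _ _ h h'
    exact vertex_injective ((le_vertex hD).symm.trans (le_vertex hD'))
  have hwinj : Function.Injective w := fun v v' h => huniq (w v) v v' (hw v) (h ▸ hw v')
  have hwsurj := Finite.surjective_of_injective hwinj
  have hθat : ∀ v, θ (at' v) = vertex (w v) := by
    intro v
    refine le_antisymm (le_of_forall_vertex fun u hu => ?_) (hw v)
    obtain ⟨v', rfl⟩ := hwsurj u
    rw [huniq _ _ _ hu (hw v')]
  have hle : ∀ v A, vertex (w v) ≤ θ A ↔ vertex v ≤ A.1 := fun v A => by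
    rw [← hθat, hθ]; rfl
  have hrank : ∀ A, (θ A).rank ≤ k := by
    rcases Nat.eq_zero_or_pos k with rfl | hk
    · intro A
      obtain ⟨v, hv⟩ := A.1.exists_vertex_le
      have hle' : A.1.rank = 0 := Nat.le_zero.mp A.2
      have : A.1 = vertex v := by
        by_contra hne
        obtain ⟨C, -, -, hC⟩ := exists_covBy_rank (lt_of_le_of_ne hv (Ne.symm hne))
        omega
      have hA : A = at' v := Subtype.ext this
      rw [hA, hθat, rank_vertex]
    · have hadj : ∀ v v', Adj v v' → Adj (w v) (w v') := by
        intro v v' h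
        obtain ⟨A, hA, hv, hv', hA'⟩ := h.exists_edge
        refine adj_of_forall_vertex_le (A := θ ⟨A, hA.trans hk⟩) ((hle _ _).mpr hv)
          ((hle _ _).mpr hv') (hwinj.ne h.1) fun u hu => ?_
        obtain ⟨u, rfl⟩ := hwsurj u
        exact (hA' u ((hle _ _).mp hu)).imp (congrArg w) (congrArg w)
      let W : {p : (∀ i, α i) × (∀ i, α i) // Adj p.1 p.2} →
          {p : (∀ i, α i) × (∀ i, α i) // Adj p.1 p.2} :=
        fun p => ⟨(w p.1.1, w p.1.2), hadj _ _ p.2⟩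
      have hW : Function.Surjective W := by
        refine Finite.surjective_of_injective fun p q h => ?_
        have h' := congrArg Subtype.val h
        exact Subtype.ext (Prod.ext (hwinj (congrArg Prod.fst h')) (hwinj (congrArg Prod.snd h')))
      have hadj' : ∀ v v', Adj (w v) (w v') → Adj v v' := by
        intro v v' h
        obtain ⟨p, hp⟩ := hW ⟨(w v, w v'), h⟩
        have hp' := congrArg Subtype.val hp
        rw [← hwinj (congrArg Prod.fst hp'), ← hwinj (congrArg Prod.snd hp')]
        exact p.2
      intro A
      obtain ⟨v, hv⟩ := A.1.exists_vertex_le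
      refine le_trans (le_of_eq ?_) A.2
      rw [rank_eq_ncard_adj ((hle v A).mpr hv), rank_eq_ncard_adj hv,
        ← ncard_image_of_injective {u | vertex u ≤ A.1 ∧ Adj v u} hwinj]
      congr 1
      ext u
      obtain ⟨u, rfl⟩ := hwsurj u
      simp only [mem_ofPred_eq, hle, hwinj.mem_set_image]
      exact and_congr_right fun _ => ⟨hadj' _ _, hadj _ _⟩
  have hinj : Function.Injective fun A => (⟨θ A, hrank A⟩ : {A : FaceTuple α // A.rank ≤ k}) := by
    intro A A' h
    have h' : θ A = θ A' := congrArg Subtype.val h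
    exact le_antisymm ((hθ _ _).mp h'.le) ((hθ _ _).mp h'.ge)
  obtain ⟨A, hA⟩ := Finite.surjective_of_injective hinj ⟨B, hB⟩
  exact ⟨A, congrArg Subtype.val hA⟩

end FaceTuple

section Faces

variable {E : Type*} [AddCommGroup E] [Module ℝ E] {P F G : Set E}

theorem IsFace.subset (h : IsFace P F) : F ⊆ P := by
  obtain ⟨-, c, rfl⟩ := h
  exact fun x hx => hx.1

theorem IsFace.inter (hF : IsFace P F) (hG : IsFace P G) (hne : (F ∩ G).Nonempty) :
    IsFace P (F ∩ G) := by
  obtain ⟨-, c, rfl⟩ := hF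
  obtain ⟨-, d, rfl⟩ := hG
  refine ⟨hne, c + d, ?_⟩
  obtain ⟨z, hz, hz'⟩ := hne
  ext x
  constructor
  · rintro ⟨hx, hx'⟩
    exact ⟨hx.1, fun y hy => add_le_add (hx.2 y hy) (hx'.2 y hy)⟩
  · rintro ⟨hx, hx'⟩
    have h1 := hx' z hz.1
    have h2 := hz.2 x hx
    have h3 := hz'.2 x hx
    simp only [LinearMap.add_apply] at h1
    exact ⟨⟨hx, fun y hy => (hz.2 y hy).trans (by linarith)⟩,
      ⟨hx, fun y hy => (hz'.2 y hy).trans (by linarith)⟩⟩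

theorem IsFace.preimage {E' : Type*} [AddCommGroup E'] [Module ℝ E'] {Q : Set E'}
    (f : E' →ₗ[ℝ] E) (h : IsFace (f '' Q) F) : IsFace Q (Q ∩ f ⁻¹' F) := by
  obtain ⟨⟨x, hx⟩, c, rfl⟩ := h
  obtain ⟨q, hq, rfl⟩ := hx.1
  refine ⟨⟨q, hq, hx⟩, c ∘ₗ f, ?_⟩
  ext y
  constructor
  · rintro ⟨hy, hy'⟩
    exact ⟨hy, fun z hz => hy'.2 _ (mem_image_of_mem f hz)⟩
  · rintro ⟨hy, hy'⟩
    exact ⟨hy, mem_image_of_mem f hy, by rintro _ ⟨z, hz, rfl⟩; exact hy' z hz⟩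

theorem polyDim_mono [FiniteDimensional ℝ E] (h : F ⊆ G) : polyDim F ≤ polyDim G :=
  Submodule.finrank_mono (AffineSubspace.direction_le (affineSpan_mono ℝ h))

theorem polyDim_lt_of_ssubset [FiniteDimensional ℝ E] (hF : IsFace P F) (hG : G ⊆ P)
    (h : F ⊂ G) : polyDim F < polyDim G := by
  obtain ⟨⟨x, hx⟩, c, rfl⟩ := hF
  obtain ⟨y, hyG, hy⟩ := exists_of_ssubset h
  refine Submodule.finrank_lt_finrank_of_lt (lt_of_le_of_ne
    (AffineSubspace.direction_le (affineSpan_mono ℝ h.subset)) fun heq => hy ?_)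
  have h1 : (affineSpan ℝ {x ∈ P | ∀ y ∈ P, c y ≤ c x}).direction ≤ LinearMap.ker c := by
    rw [direction_affineSpan, vectorSpan_def, Submodule.span_le]
    rintro _ ⟨a, ha, b, hb, rfl⟩
    simp only [SetLike.mem_coe, LinearMap.mem_ker, vsub_eq_sub, map_sub]
    exact sub_eq_zero.mpr (le_antisymm (hb.2 a ha.1) (ha.2 b hb.1))
  have h2 : y - x ∈ (affineSpan ℝ G).direction :=
    AffineSubspace.vsub_mem_direction (subset_affineSpan ℝ G hyG)
      (subset_affineSpan ℝ G (h.subset hx))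
  rw [← heq] at h2
  have h3 : c y = c x := by simpa [sub_eq_zero] using h1 h2
  exact ⟨hG hyG, fun z hz => (hx.2 z hz).trans h3.ge⟩

theorem isFace_self (hP : P.Nonempty) : IsFace P P :=
  ⟨hP, 0, by simp⟩

end Faces

section ProdSimplex

variable {r : ℕ} {n : Fin r → ℕ}

theorem mem_prodSimplex {x : (i : Fin r) → Fin (n i + 1) → ℝ} :
    x ∈ prodSimplex n ↔ ∀ i, (∀ j, 0 ≤ x i j) ∧ ∑ j, x i j = 1 := by
  simp [prodSimplex, stdSimplex]

/-- The face of a product of simplices encoded by a tuple of vertex sets. -/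
def tupleFace (A : FaceTuple fun i => Fin (n i + 1)) : Set ((i : Fin r) → Fin (n i + 1) → ℝ) :=
  {x ∈ prodSimplex n | ∀ i, ∀ j ∉ A.1 i, x i j = 0}

/-- The vertex of a product of simplices as a point. -/
def vertexPoint (v : ∀ i, Fin (n i + 1)) : (i : Fin r) → Fin (n i + 1) → ℝ :=
  fun i => Pi.single (v i) 1

theorem vertexPoint_mem_prodSimplex (v : ∀ i, Fin (n i + 1)) :
    vertexPoint v ∈ prodSimplex n := by
  rw [mem_prodSimplex]
  refine fun i => ⟨fun j => ?_, by simp [vertexPoint]⟩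
  by_cases h : j = v i
  · subst h; simp [vertexPoint]
  · simp [vertexPoint, h]

theorem vertexPoint_mem_tupleFace {v : ∀ i, Fin (n i + 1)}
    {A : FaceTuple fun i => Fin (n i + 1)} :
    vertexPoint v ∈ tupleFace A ↔ FaceTuple.vertex v ≤ A := by
  rw [FaceTuple.vertex_le]
  refine ⟨fun h i => ?_, fun h => ⟨vertexPoint_mem_prodSimplex v, fun i j hj => ?_⟩⟩
  · by_contra hi
    simpa [vertexPoint] using h.2 i _ hi
  · exact Pi.single_eq_of_ne (ne_of_mem_of_not_mem (h i) hj).symm _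

theorem tupleFace_subset_iff {A B : FaceTuple fun i => Fin (n i + 1)} :
    tupleFace A ⊆ tupleFace B ↔ A ≤ B :=
  ⟨fun h => FaceTuple.le_of_forall_vertex fun _ hv =>
    vertexPoint_mem_tupleFace.mp (h (vertexPoint_mem_tupleFace.mpr hv)),
  fun h _ hx => ⟨hx.1, fun i j hj => hx.2 i j fun hA => hj (h i hA)⟩⟩

theorem isFace_prodSimplex_of_coeff (c : ((i : Fin r) → Fin (n i + 1) → ℝ) →ₗ[ℝ] ℝ)
    (C : ∀ i, Fin (n i + 1) → ℝ) (hc : ∀ x, c x = ∑ i, ∑ j, C i j * x i j)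
    (A : FaceTuple fun i => Fin (n i + 1)) (hA : ∀ i, ∀ j ∈ A.1 i, ∀ j', C i j' ≤ C i j)
    (hA' : ∀ i, ∀ j ∉ A.1 i, ∀ j' ∈ A.1 i, C i j < C i j') :
    {x ∈ prodSimplex n | ∀ y ∈ prodSimplex n, c y ≤ c x} = tupleFace A := by
  obtain ⟨v, hv⟩ := A.exists_vertex_le
  have hvA := FaceTuple.vertex_le.mp hv
  have hdiff : ∀ x ∈ prodSimplex n,
      (∑ i, C i (v i)) - c x = ∑ i, ∑ j, (C i (v i) - C i j) * x i j := by
    intro x hx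
    rw [mem_prodSimplex] at hx
    simp only [hc, sub_mul, Finset.sum_sub_distrib, ← Finset.mul_sum, (hx _).2, mul_one]
  have hterm : ∀ x ∈ prodSimplex n, ∀ i j, 0 ≤ (C i (v i) - C i j) * x i j := fun x hx i j =>
    mul_nonneg (sub_nonneg.mpr (hA i _ (hvA i) j)) ((mem_prodSimplex.mp hx i).1 j)
  have hvP : ∑ i, C i (v i) = c (vertexPoint v) := by
    rw [hc]
    exact Finset.sum_congr rfl fun i _ => by simp [vertexPoint, Pi.single_apply]
  ext x
  constructor
  · rintro ⟨hx, hmax⟩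
    refine ⟨hx, fun i j hj => ?_⟩
    have h1 := hmax _ (vertexPoint_mem_prodSimplex v)
    rw [← hvP] at h1
    have h2 : ∑ i, ∑ j, (C i (v i) - C i j) * x i j = 0 :=
      le_antisymm ((hdiff x hx).symm.trans_le (by linarith))
        (Finset.sum_nonneg fun i _ => Finset.sum_nonneg fun j _ => hterm x hx i j)
    have h3 := (Finset.sum_eq_zero_iff_of_nonneg fun i _ =>
      Finset.sum_nonneg fun j _ => hterm x hx i j).mp h2 i (Finset.mem_univ i)
    have h4 := (Finset.sum_eq_zero_iff_of_nonneg fun j _ => hterm x hx i j).mp h3 j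
      (Finset.mem_univ j)
    exact (mul_eq_zero.mp h4).resolve_left (sub_pos.mpr (hA' i j hj _ (hvA i))).ne'
  · rintro ⟨hx, hx0⟩
    refine ⟨hx, fun y hy => ?_⟩
    have h1 : ∑ i, ∑ j, (C i (v i) - C i j) * x i j = 0 := by
      refine Finset.sum_eq_zero fun i _ => Finset.sum_eq_zero fun j _ => ?_
      by_cases hj : j ∈ A.1 i
      · rw [le_antisymm (hA i _ (hvA i) j) (hA i _ hj (v i)), sub_self, zero_mul]
      · rw [hx0 i j hj, mul_zero]
    have h2 := hdiff y hy
    have h3 : 0 ≤ ∑ i, ∑ j, (C i (v i) - C i j) * y i j :=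
      Finset.sum_nonneg fun i _ => Finset.sum_nonneg fun j _ => hterm y hy i j
    have h4 := hdiff x hx
    linarith

theorem isFace_tupleFace (A : FaceTuple fun i => Fin (n i + 1)) :
    IsFace (prodSimplex n) (tupleFace A) := by
  classical
  obtain ⟨v, hv⟩ := A.exists_vertex_le
  let C : ∀ i, Fin (n i + 1) → ℝ := fun i j => if j ∈ A.1 i then 1 else 0
  let c : ((i : Fin r) → Fin (n i + 1) → ℝ) →ₗ[ℝ] ℝ :=
    ∑ i, ∑ j, C i j •
      ((LinearMap.proj j : (Fin (n i + 1) → ℝ) →ₗ[ℝ] ℝ) ∘ₗ LinearMap.proj i)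
  refine ⟨⟨_, vertexPoint_mem_tupleFace.mpr hv⟩, c, (isFace_prodSimplex_of_coeff c C
    (fun x => by simp [c, LinearMap.sum_apply]) A (fun i j hj j' => ?_)
    fun i j hj j' hj' => ?_).symm⟩
  · simp only [C, hj, if_true]
    split_ifs <;> norm_num
  · simp [C, hj, hj']

theorem exists_tupleFace_eq {F : Set ((i : Fin r) → Fin (n i + 1) → ℝ)}
    (hF : IsFace (prodSimplex n) F) : ∃ A, tupleFace A = F := by
  classical
  obtain ⟨-, c, rfl⟩ := hF
  let C : ∀ i, Fin (n i + 1) → ℝ := fun i j => c (Pi.single i (Pi.single j 1))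
  refine ⟨⟨fun i => Finset.univ.filter fun j => ∀ j', C i j' ≤ C i j, fun i => ?_⟩,
    (isFace_prodSimplex_of_coeff c C (fun x => ?_) _ (fun i j hj => ?_)
      fun i j hj j' hj' => ?_).symm⟩
  · obtain ⟨j, hj⟩ := Finite.exists_max (C i)
    exact ⟨j, by simpa using hj⟩
  · have : x = ∑ i, ∑ j, x i j • (Pi.single i (Pi.single j 1) :
        (i : Fin r) → Fin (n i + 1) → ℝ) := by
      conv_lhs => rw [← Finset.univ_sum_single x]
      refine Finset.sum_congr rfl fun i _ => ?_
      rw [← Finset.univ_sum_single (x i), ← LinearMap.coe_single ℝ, map_sum]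
      refine Finset.sum_congr rfl fun j _ => ?_
      rw [← map_smul]
      congr 1
      ext l
      by_cases h : l = j
      · subst h; simp
      · simp [h]
    conv_lhs => rw [this]
    simp only [map_sum, map_smul, smul_eq_mul, C, mul_comm]
  · simpa using hj
  · simp only [Finset.mem_filter, Finset.mem_univ, true_and, not_forall, not_le] at hj hj'
    obtain ⟨l, hl⟩ := hj
    exact hl.trans_le (hj' l)

/-- The face lattice of a product of simplices. -/
noncomputable def faceTupleOrderIso (n : Fin r → ℕ) :
    FaceTuple (fun i => Fin (n i + 1)) ≃o facesOf (prodSimplex n) where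
  toEquiv := Equiv.ofBijective (fun A => ⟨tupleFace A, isFace_tupleFace A⟩)
    ⟨fun A B h => by
      have h' : tupleFace A = tupleFace B := congrArg Subtype.val h
      exact le_antisymm (tupleFace_subset_iff.mp h'.le) (tupleFace_subset_iff.mp h'.ge),
    fun F => by
      obtain ⟨A, hA⟩ := exists_tupleFace_eq F.2
      exact ⟨A, Subtype.ext hA⟩⟩
  map_rel_iff' := tupleFace_subset_iff

theorem polyDim_prodSimplex_le (n : Fin r → ℕ) : polyDim (prodSimplex n) ≤ ∑ i, n i := by
  let L : ((i : Fin r) → Fin (n i + 1) → ℝ) →ₗ[ℝ] (Fin r → ℝ) :=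
    LinearMap.pi fun i => ∑ j, LinearMap.proj j ∘ₗ LinearMap.proj i
  have hL : ∀ x i, L x i = ∑ j, x i j := fun x i => by simp [L]
  have hsurj : Function.Surjective L := fun y =>
    ⟨fun i => Pi.single 0 (y i), funext fun i => by simp [hL]⟩
  have hle : (affineSpan ℝ (prodSimplex n)).direction ≤ LinearMap.ker L := by
    rw [direction_affineSpan, vectorSpan_def, Submodule.span_le]
    rintro _ ⟨a, ha, b, hb, rfl⟩
    rw [mem_prodSimplex] at ha hb
    simp only [SetLike.mem_coe, LinearMap.mem_ker, vsub_eq_sub, map_sub]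
    funext i
    simp [hL, (ha i).2, (hb i).2]
  have h1 := Submodule.finrank_mono hle
  have h2 := L.finrank_range_add_finrank_ker
  rw [LinearMap.range_eq_top.mpr hsurj, finrank_top, Module.finrank_fin_fun,
    Module.finrank_pi_fintype] at h2
  simp only [Module.finrank_fin_fun, Finset.sum_add_distrib, Finset.sum_const, Finset.card_univ,
    Fintype.card_fin, smul_eq_mul, mul_one] at h2
  exact h1.trans (by omega)

/-- The full tuple, encoding a product of simplices as a face of itself. -/
def FaceTuple.full (n : Fin r → ℕ) : FaceTuple fun i => Fin (n i + 1) :=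
  ⟨fun _ => Finset.univ, fun _ => Finset.univ_nonempty⟩

theorem FaceTuple.le_full (A : FaceTuple fun i => Fin (n i + 1)) : A ≤ FaceTuple.full n :=
  fun i => Finset.subset_univ (A.1 i)

theorem FaceTuple.rank_full (n : Fin r → ℕ) : (FaceTuple.full n).rank = ∑ i, n i := by
  simp [FaceTuple.rank, FaceTuple.full]

theorem strictMono_polyDim {E : Type*} [AddCommGroup E] [Module ℝ E] [FiniteDimensional ℝ E]
    {P : Set E} {T : Type*} [Preorder T] (e : T ≃o facesOf P) :
    StrictMono fun A => polyDim (e A : Set E) := fun A B h =>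
  polyDim_lt_of_ssubset (e A).2 (e B).2.subset (e.strictMono h)

theorem polyDim_tupleFace (A : FaceTuple fun i => Fin (n i + 1)) :
    polyDim (tupleFace A) = A.rank := by
  have hD := strictMono_polyDim (faceTupleOrderIso n)
  obtain ⟨v, hv⟩ := A.exists_vertex_le
  have h1 := FaceTuple.add_rank_le_of_strictMono hD hv
  have h2 := FaceTuple.add_rank_le_of_strictMono hD A.le_full
  have h3 : polyDim (tupleFace (FaceTuple.full n)) ≤ ∑ i, n i :=
    (polyDim_mono (isFace_tupleFace _).subset).trans (polyDim_prodSimplex_le n)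
  rw [FaceTuple.rank_vertex] at h1
  rw [FaceTuple.rank_full] at h2
  change polyDim (tupleFace _) + _ ≤ polyDim (tupleFace _) + _ at h1 h2
  omega

theorem sum_le_polyDim {E : Type*} [AddCommGroup E] [Module ℝ E] [FiniteDimensional ℝ E]
    {Q : Set E} (e : FaceTuple (fun i => Fin (n i + 1)) ≃o facesOf Q) :
    ∑ i, n i ≤ polyDim Q := by
  obtain ⟨v, hv⟩ := (FaceTuple.full n).exists_vertex_le
  have h := FaceTuple.add_rank_le_of_strictMono (strictMono_polyDim e) hv
  have h' : polyDim (e (FaceTuple.full n) : Set E) ≤ polyDim Q := polyDim_mono (e _).2.subset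
  rw [FaceTuple.rank_full, FaceTuple.rank_vertex] at h
  omega

end ProdSimplex

theorem IsFace.exists_level {E : Type*} [AddCommGroup E] [Module ℝ E] {Q F : Set E}
    (hF : IsFace Q F) : ∃ (c : E →ₗ[ℝ] ℝ) (h : ℝ),
      (∀ x ∈ Q, c x ≤ h) ∧ ∀ x, x ∈ F ↔ x ∈ Q ∧ c x = h := by
  obtain ⟨⟨z, hz⟩, c, rfl⟩ := hF
  exact ⟨c, c z, hz.2, fun x => ⟨fun hx => ⟨hx.1, le_antisymm (hz.2 x hx.1) (hx.2 z hz.1)⟩,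
    fun hx => ⟨hx.1, fun y hy => (hz.2 y hy).trans hx.2.ge⟩⟩⟩

theorem IsFace.convex {E : Type*} [AddCommGroup E] [Module ℝ E] {Q F : Set E}
    (hQ : Convex ℝ Q) (hF : IsFace Q F) : Convex ℝ F := by
  obtain ⟨c, h, -, hF'⟩ := hF.exists_level
  have : F = Q ∩ {x | c x = h} := ext hF'
  rw [this]
  exact hQ.inter (convex_hyperplane c.isLinear h)

/-- A convex subset contained in none of finitely many faces has a point in none of them. -/
theorem exists_mem_forall_mem_imp_subset {E κ : Type*} [AddCommGroup E] [Module ℝ E]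
    {Q C : Set E} (hCQ : C ⊆ Q) (hC : Convex ℝ C) (hne : C.Nonempty) (Φ : κ → Set E)
    (hΦ : ∀ l, IsFace Q (Φ l)) (s : Finset κ) :
    ∃ x ∈ C, ∀ l ∈ s, x ∈ Φ l → C ⊆ Φ l := by
  classical
  induction s using Finset.induction_on with
  | empty => exact ⟨_, hne.some_mem, by simp⟩
  | insert l s _ ih =>
    obtain ⟨x, hx, hxs⟩ := ih
    by_cases hl : C ⊆ Φ l
    · exact ⟨x, hx, fun m hm => by
        rcases Finset.mem_insert.mp hm with rfl | hm
        exacts [fun _ => hl, hxs m hm]⟩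
    · obtain ⟨y, hy, hyl⟩ := not_subset.mp hl
      have hmid : ∀ m, midpoint ℝ x y ∈ Φ m → x ∈ Φ m ∧ y ∈ Φ m := by
        intro m hm
        obtain ⟨c, h, hle, hmem⟩ := (hΦ m).exists_level
        have h1 := ((hmem _).mp hm).2
        rw [midpoint_eq_smul_add] at h1
        simp only [map_smul, map_add, smul_eq_mul, invOf_eq_inv] at h1
        have h2 := hle x (hCQ hx)
        have h3 := hle y (hCQ hy)
        exact ⟨(hmem x).mpr ⟨hCQ hx, by linarith⟩, (hmem y).mpr ⟨hCQ hy, by linarith⟩⟩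
      refine ⟨midpoint ℝ x y, hC.midpoint_mem hx hy, fun m hm hmm => ?_⟩
      rcases Finset.mem_insert.mp hm with rfl | hm
      · exact absurd (hmid _ hmm).2 hyl
      · exact hxs m hm (hmid m hmm).1

section Convex

variable {E : Type*} [NormedAddCommGroup E] [NormedSpace ℝ E] {Q : Set E}

theorem Convex.exists_linearMap_nonpos_of_forall_smul_notMem [FiniteDimensional ℝ E]
    (hQ : Convex ℝ Q) (h0 : 0 ∈ Q) {w : E} (hw : w ∈ Submodule.span ℝ Q)
    (h : ∀ ε : ℝ, 0 < ε → ε • w ∉ Q) :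
    ∃ c : E →ₗ[ℝ] ℝ, (∀ x ∈ Q, c x ≤ 0) ∧ ∃ x ∈ Q, c x < 0 := by
  set D := Submodule.span ℝ Q with hD
  let K : Set D := (↑) ⁻¹' Q
  have hK : Convex ℝ K := hQ.linear_preimage D.subtype
  have hK0 : (0 : D) ∈ K := h0
  have hint : (interior K).Nonempty := by
    rw [hK.interior_nonempty_iff_affineSpan_eq_top,
      AffineSubspace.affineSpan_eq_top_iff_vectorSpan_eq_top_of_nonempty _ _ _ ⟨0, hK0⟩,
      vectorSpan_eq_span_vsub_set_right ℝ hK0]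
    simp only [vsub_eq_sub, sub_zero, image_id']
    exact Submodule.span_span_coe_preimage (R := ℝ) (s := Q)
  have h0int : (0 : D) ∉ interior K := by
    intro hmem
    have hcont : Filter.Tendsto (fun ε : ℝ => ε • (⟨w, hw⟩ : D)) (nhdsWithin 0 (Ioi 0))
        (nhds 0) := by
      have : Continuous fun ε : ℝ => ε • (⟨w, hw⟩ : D) := by fun_prop
      simpa using (this.tendsto 0).mono_left nhdsWithin_le_nhds
    obtain ⟨ε, hε, hε0⟩ := ((hcont.eventually (mem_interior_iff_mem_nhds.mp hmem)).and
      self_mem_nhdsWithin).exists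
    exact h ε hε0 hε
  obtain ⟨g, hg⟩ := geometric_hahn_banach_open_point hK.interior isOpen_interior h0int
  simp only [map_zero] at hg
  obtain ⟨c, hc⟩ := LinearMap.exists_extend (g : D →ₗ[ℝ] ℝ)
  have hcg : ∀ v : D, c v = g v := fun v => LinearMap.congr_fun hc v
  refine ⟨c, fun x hx => ?_, ?_⟩
  · have hxK : (⟨x, Submodule.subset_span hx⟩ : D) ∈ closure (interior K) := by
      rw [hK.closure_interior_eq_closure_of_nonempty_interior hint]
      exact subset_closure hx
    rw [hcg ⟨x, Submodule.subset_span hx⟩]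
    exact closure_minimal (fun v hv => (hg v hv).le)
      (isClosed_le g.continuous continuous_const) hxK
  · obtain ⟨v, hv⟩ := hint
    exact ⟨v, (interior_subset hv : v ∈ K), (hcg v).trans_lt (hg v hv)⟩

theorem Convex.exists_isFace_ne_of_forall_notMem [FiniteDimensional ℝ E]
    (hQ : Convex ℝ Q) {b w : E} (hb : b ∈ Q) (hw : w ∈ vectorSpan ℝ Q)
    (h : ∀ ε : ℝ, 0 < ε → b + ε • w ∉ Q) : ∃ F, IsFace Q F ∧ b ∈ F ∧ F ≠ Q := by
  rw [vectorSpan_eq_span_vsub_set_right ℝ hb] at hw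
  obtain ⟨c, hc, z, hz, hz0⟩ := Convex.exists_linearMap_nonpos_of_forall_smul_notMem
    (Q := (· -ᵥ b) '' Q) (by simpa [sub_eq_add_neg, add_comm] using hQ.translate (-b))
    ⟨b, hb, by simp⟩ hw (by
      rintro ε hε ⟨x, hx, hxe⟩
      refine h ε hε ?_
      rw [← hxe]
      simpa using hx)
  obtain ⟨q, hq, rfl⟩ := hz
  have hcb : ∀ x ∈ Q, c x ≤ c b := fun x hx => by
    simpa using hc _ (mem_image_of_mem _ hx)
  have hbF : b ∈ {x ∈ Q | ∀ y ∈ Q, c y ≤ c x} := ⟨hb, hcb⟩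
  refine ⟨_, ⟨⟨b, hbF⟩, c, rfl⟩, hbF, fun heq => ?_⟩
  have hqF : q ∈ {x ∈ Q | ∀ y ∈ Q, c y ≤ c x} := heq.ge hq
  have := hqF.2 b hb
  simp only [vsub_eq_sub, map_sub] at hz0
  linarith

theorem IsCompact.exists_last_mem_ray (hQ : IsCompact Q) {x y : E} (hx : x ∈ Q) (hy : y ≠ 0) :
    ∃ τ : ℝ, 0 ≤ τ ∧ x + τ • y ∈ Q ∧ ∀ ε : ℝ, 0 < ε → x + (τ + ε) • y ∉ Q := by
  have hemb : Topology.IsClosedEmbedding fun t : ℝ => x + t • y :=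
    (Homeomorph.addLeft x).isClosedEmbedding.comp (isClosedEmbedding_smul_left hy)
  have hK := hemb.isCompact_preimage hQ
  obtain ⟨τ, hτ, hmax⟩ := hK.exists_isMaxOn ⟨0, by simpa using hx⟩ continuousOn_id
  refine ⟨τ, hmax (show (0 : ℝ) ∈ _ by simpa using hx), hτ, fun ε hε hmem => ?_⟩
  have : τ + ε ≤ τ := hmax hmem
  linarith

/-- A compact convex set each of whose proper faces lies in one of the hyperplanes `a l = h l` is
cut out in its affine hull by the inequalities `a l ≤ h l`. -/
theorem Convex.mem_of_forall_le [FiniteDimensional ℝ E] (hQ : Convex ℝ Q) (hQc : IsCompact Q)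
    {κ : Type*} {a : κ → E →ₗ[ℝ] ℝ} {h : κ → ℝ}
    (hfaces : ∀ F, IsFace Q F → F ≠ Q → ∃ l, ∀ x ∈ F, a l x = h l)
    {p : E} (hp : p ∈ Q) (hp' : ∀ l, a l p < h l) {q : E} (hq : q - p ∈ vectorSpan ℝ Q)
    (hq' : ∀ l, a l q ≤ h l) : q ∈ Q := by
  by_contra hqQ
  have hne : q - p ≠ 0 := fun h0 => hqQ (by rwa [sub_eq_zero.mp h0])
  obtain ⟨t, ht0, ht, hlast⟩ := hQc.exists_last_mem_ray hp hne
  have ht1 : t < 1 := by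
    by_contra! ht1
    refine hqQ ?_
    have h1 : p + t⁻¹ • ((p + t • (q - p)) - p) ∈ Q :=
      hQ.add_smul_sub_mem hp ht ⟨by positivity, inv_le_one_of_one_le₀ ht1⟩
    rwa [add_sub_cancel_left, smul_smul, inv_mul_cancel₀ (by positivity), one_smul,
      add_sub_cancel] at h1
  obtain ⟨F, hF, hbF, hFQ⟩ := hQ.exists_isFace_ne_of_forall_notMem ht hq fun ε hε => by
    rw [add_assoc, ← add_smul]
    exact hlast ε hε
  obtain ⟨l, hl⟩ := hfaces F hF hFQ
  have h1 := hl _ hbF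
  simp only [map_add, map_smul, map_sub, smul_eq_mul] at h1
  nlinarith [hp' l, hq' l]

theorem Convex.exists_add_smul_mem [FiniteDimensional ℝ E] (hQ : Convex ℝ Q) (hQc : IsCompact Q)
    {κ : Type*} [Finite κ] {a : κ → E →ₗ[ℝ] ℝ} {h : κ → ℝ} (hle : ∀ l, ∀ x ∈ Q, a l x ≤ h l)
    (hfaces : ∀ F, IsFace Q F → F ≠ Q → ∃ l, ∀ x ∈ F, a l x = h l)
    {p : E} (hp : p ∈ Q) (hp' : ∀ l, a l p < h l) {x y : E} (hx : x ∈ Q)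
    (hy : y ∈ vectorSpan ℝ Q) (hxy : ∀ l, a l x = h l → a l y ≤ 0) :
    ∃ ε : ℝ, 0 < ε ∧ x + ε • y ∈ Q := by
  have hev : ∀ᶠ ε : ℝ in nhdsWithin 0 (Ioi 0), ∀ l, a l (x + ε • y) ≤ h l := by
    refine Filter.eventually_all.mpr fun l => ?_
    rcases (hle l x hx).eq_or_lt with heq | hlt
    · filter_upwards [self_mem_nhdsWithin] with ε hε
      rw [map_add, map_smul, smul_eq_mul]
      nlinarith [hxy l heq, mem_Ioi.mp hε]
    · have hcont : Continuous fun ε : ℝ => a l (x + ε • y) := by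
        simp only [map_add, map_smul, smul_eq_mul]
        fun_prop
      have := (hcont.tendsto 0).mono_left (nhdsWithin_le_nhds (s := Ioi 0))
      rw [zero_smul, add_zero] at this
      exact (this.eventually_lt_const hlt).mono fun _ hε => hε.le
  obtain ⟨ε, hε, hε0⟩ := (hev.and self_mem_nhdsWithin).exists
  refine ⟨ε, hε0, hQ.mem_of_forall_le hQc hfaces hp hp' ?_ hε⟩
  rw [add_sub_right_comm]
  exact Submodule.add_mem _ (vsub_mem_vectorSpan ℝ hx hp) (Submodule.smul_mem _ _ hy)

end Convex

section Projection

variable {r : ℕ} {n : Fin r → ℕ}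

/-- If the linear projection of a product of simplices preserves the poset of the `k`-skeleton,
then its faces of dimension at most `k` are unions of fibres. -/
theorem mem_face_of_map_eq {k : ℕ} {E E' : Type*} [AddCommGroup E] [Module ℝ E]
    [FiniteDimensional ℝ E] [AddCommGroup E'] [Module ℝ E'] {Q : Set E'} {f : E' →ₗ[ℝ] E}
    (s : skel k (f '' Q) ≃o skel k (prodSimplex n))
    (e : FaceTuple (fun i => Fin (n i + 1)) ≃o facesOf Q)
    {A : FaceTuple fun i => Fin (n i + 1)} (hA : A.rank ≤ k) {x x' : E'}
    (hx : x ∈ (e A : Set E')) (hx' : x' ∈ Q) (hf : f x' = f x) : x' ∈ (e A : Set E') := by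
  let G : {A : FaceTuple fun i => Fin (n i + 1) // A.rank ≤ k} → skel k (f '' Q) := fun A =>
    s.symm ⟨tupleFace A.1, isFace_tupleFace A.1, (polyDim_tupleFace A.1).trans_le A.2⟩
  have hGle : ∀ A B, (G A : Set E) ⊆ G B ↔ A ≤ B := fun A B =>
    (s.symm.le_iff_le (x := ⟨tupleFace A.1, isFace_tupleFace A.1,
      (polyDim_tupleFace A.1).trans_le A.2⟩)).trans tupleFace_subset_iff
  have hGface : ∀ A, IsFace (f '' Q) (G A) := fun A => (G A).2.1
  let θ : {A : FaceTuple fun i => Fin (n i + 1) // A.rank ≤ k} →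
      FaceTuple fun i => Fin (n i + 1) :=
    fun A => e.symm ⟨Q ∩ f ⁻¹' G A, (hGface A).preimage f⟩
  have hθ : ∀ A, (e (θ A) : Set E') = Q ∩ f ⁻¹' G A := fun A => by simp [θ]
  have hθle : ∀ A B, θ A ≤ θ B ↔ A ≤ B := by
    intro A B
    rw [← hGle, ← e.le_iff_le, ← Subtype.coe_le_coe, hθ, hθ]
    refine ⟨fun h y hy => ?_, fun h => inter_subset_inter_right _ (preimage_mono h)⟩
    obtain ⟨q, hq, rfl⟩ := (hGface A).subset hy
    exact (h ⟨hq, hy⟩).2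
  obtain ⟨A', rfl⟩ := FaceTuple.exists_eq_of_rank_le θ hθle (fun A B C hCA hCB => by
    obtain ⟨q, hq⟩ := (e C).2.1
    have hqA := e.monotone hCA hq
    have hqB := e.monotone hCB hq
    rw [hθ] at hqA hqB
    have hface := (hGface A).inter (hGface B) ⟨f q, hqA.2, hqB.2⟩
    let H : skel k (f '' Q) := ⟨_, hface, (polyDim_mono inter_subset_left).trans (G A).2.2⟩
    obtain ⟨D, hD⟩ := exists_tupleFace_eq (s H).2.1
    have hDk : D.rank ≤ k := by
      rw [← polyDim_tupleFace, hD]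
      exact (s H).2.2
    have hDG : G ⟨D, hDk⟩ = H := (s.symm_apply_eq).mpr (Subtype.ext hD)
    refine ⟨⟨D, hDk⟩, (hGle _ _).mp ?_, (hGle _ _).mp ?_⟩
    · rw [hDG]; exact inter_subset_left
    · rw [hDG]; exact inter_subset_right) hA
  rw [hθ] at hx ⊢
  exact ⟨hx', by rw [mem_preimage, hf]; exact hx.2⟩

/-- The tuple encoding the facet of a product of simplices opposite to the vertex `j` of the
`i`-th factor. -/
def FaceTuple.facet (hn : ∀ i, 1 ≤ n i) (i : Fin r) (j : Fin (n i + 1)) :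
    FaceTuple fun i => Fin (n i + 1) :=
  ⟨Function.update (fun _ => Finset.univ) i (Finset.univ.erase j), fun l => by
    by_cases h : l = i
    · subst h
      rw [Function.update_self, ← Finset.card_pos, Finset.card_erase_of_mem (Finset.mem_univ _),
        Finset.card_univ, Fintype.card_fin]
      exact hn l
    · rw [Function.update_of_ne h]
      exact Finset.univ_nonempty⟩

theorem FaceTuple.le_facet (hn : ∀ i, 1 ≤ n i) {i : Fin r} {j : Fin (n i + 1)}
    {A : FaceTuple fun i => Fin (n i + 1)} : A ≤ FaceTuple.facet hn i j ↔ j ∉ A.1 i := by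
  constructor
  · intro h hj
    have := h i hj
    simp [FaceTuple.facet] at this
  · intro h l x hx
    by_cases hl : l = i
    · subst hl
      simpa [FaceTuple.facet] using ne_of_mem_of_not_mem hx h
    · simp [FaceTuple.facet, hl]

theorem finrank_ker_domRestrict_add_polyDim {E E' : Type*} [AddCommGroup E] [Module ℝ E]
    [AddCommGroup E'] [Module ℝ E'] [FiniteDimensional ℝ E'] (f : E' →ₗ[ℝ] E) (Q : Set E') :
    Module.finrank ℝ (LinearMap.ker (f.domRestrict (vectorSpan ℝ Q))) + polyDim (f '' Q)
      = polyDim Q := by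
  have h1 := (f.domRestrict (vectorSpan ℝ Q)).finrank_range_add_finrank_ker
  have h2 : vectorSpan ℝ (f '' Q) = (vectorSpan ℝ Q).map f :=
    (AffineMap.map_vectorSpan (f := f.toAffineMap)).symm
  rw [polyDim, polyDim, direction_affineSpan, direction_affineSpan, h2,
    ← LinearMap.range_domRestrict, add_comm]
  exact h1

end Projection

/-- Corollary `topObstr` (1). With `S = {i : n_i = 1}` and
`R = {i : n_i ≥ 2}`, if `0 ≤ k ≤ Σ_{i∈R} ⌊(n_i-2)/2⌋ + max{0, ⌊(|S|-1)/2⌋}`, then every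
`(k,n̄)`-PPSN polytope has dimension at least `2k + |R| + 1`. -/
theorem statement16 (k r : ℕ) (hr : 1 ≤ r) (n : Fin r → ℕ) (hn : ∀ i, 1 ≤ n i)
    (hk : k ≤ (∑ i ∈ Finset.univ.filter (fun i : Fin r => 2 ≤ n i), (n i - 2) / 2)
        + max 0 (((Finset.univ.filter (fun i : Fin r => n i = 1)).card - 1) / 2)) :
    ∀ (d : ℕ) (P : Set (Fin d → ℝ)), IsPPSN k n P →
      2 * k + (Finset.univ.filter (fun i : Fin r => 2 ≤ n i)).card + 1 ≤ polyDim P := by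
  rintro d _ ⟨⟨-, ⟨s⟩⟩, N, Q, f, ⟨W, hW⟩, rfl, ⟨e₀⟩⟩
  let e := (faceTupleOrderIso n).trans e₀.symm
  have hQ : Convex ℝ Q := by rw [hW]; exact convex_convexHull ℝ _
  have hQc : IsCompact Q := by rw [hW]; exact W.finite_toSet.isCompact_convexHull ℝ
  have hQne : Q.Nonempty := (e (FaceTuple.full n)).2.1.mono (e (FaceTuple.full n)).2.subset
  have hfull : (e (FaceTuple.full n) : Set (Fin N → ℝ)) = Q := by
    refine (e (FaceTuple.full n)).2.subset.antisymm ?_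
    have h : (⟨Q, isFace_self hQne⟩ : facesOf Q) ≤ e (FaceTuple.full n) :=
      e.symm_apply_le.mp (FaceTuple.le_full _)
    exact h
  have hsub : ∀ A B, (e A : Set (Fin N → ℝ)) ⊆ e B ↔ A ≤ B := fun A B => e.le_iff_le
  let Φ : (Σ i, Fin (n i + 1)) → Set (Fin N → ℝ) := fun l => e (FaceTuple.facet hn l.1 l.2)
  have hΦ : ∀ l, IsFace Q (Φ l) := fun l => (e _).2
  have hsubΦ : ∀ A l, (e A : Set (Fin N → ℝ)) ⊆ Φ l ↔ l.2 ∉ A.1 l.1 := fun A l =>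
    (hsub _ _).trans (FaceTuple.le_facet hn)
  choose a h hle hmem using fun l => (hΦ l).exists_level
  have hfaces : ∀ F, IsFace Q F → F ≠ Q → ∃ l, ∀ x ∈ F, a l x = h l := by
    intro F hF hFQ
    obtain ⟨B, hB⟩ := e.surjective ⟨F, hF⟩
    obtain rfl : (e B : Set (Fin N → ℝ)) = F := congrArg Subtype.val hB
    obtain ⟨i, j, hj⟩ : ∃ i j, j ∉ B.1 i := by
      by_contra! hcon
      obtain rfl : B = FaceTuple.full n := le_antisymm B.le_full fun i j _ => hcon i j
      exact hFQ hfull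
    exact ⟨⟨i, j⟩, fun x hx => ((hmem _ x).mp ((hsubΦ B ⟨i, j⟩).mpr hj hx)).2⟩
  obtain ⟨p, hp, hpΦ⟩ := exists_mem_forall_mem_imp_subset subset_rfl hQ hQne Φ hΦ Finset.univ
  have hp' : ∀ l, a l p < h l := fun l => (hle l p hp).lt_of_ne fun heq => by
    have h1 := hpΦ l (Finset.mem_univ l) ((hmem l p).mpr ⟨hp, heq⟩)
    rw [← hfull, hsubΦ] at h1
    exact h1 (Finset.mem_univ _)
  by_contra! hlt
  have hdim := finrank_ker_domRestrict_add_polyDim f Q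
  have hsum := sum_le_polyDim e
  rw [Nat.zero_max] at hk
  obtain ⟨y, hy0, hy⟩ := exists_ne_zero_sum_card_pos_sub_one_le
    (V := LinearMap.ker (f.domRestrict (vectorSpan ℝ Q))) hr hn hk
    (fun i j => a ⟨i, j⟩ ∘ₗ Submodule.subtype _ ∘ₗ Submodule.subtype _) (by omega)
  obtain ⟨z, hz0, hfz, hzQ, hz⟩ : ∃ z, z ≠ 0 ∧ f z = 0 ∧ z ∈ vectorSpan ℝ Q ∧
      ∑ i, ((Finset.univ.filter fun j => 0 < a ⟨i, j⟩ z).card - 1) ≤ k :=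
    ⟨(y : vectorSpan ℝ Q), by simpa using hy0, y.2, y.1.2, by convert hy; rfl⟩
  have hA : ∀ i, ∃ B : Finset (Fin (n i + 1)), B.Nonempty ∧ (∀ j, 0 < a ⟨i, j⟩ z → j ∈ B) ∧
      B.card - 1 ≤ (Finset.univ.filter fun j => 0 < a ⟨i, j⟩ z).card - 1 := by
    intro i
    rcases (Finset.univ.filter fun j => 0 < a ⟨i, j⟩ z).eq_empty_or_nonempty with h0 | h0
    · exact ⟨{0}, Finset.singleton_nonempty _, fun j hj => absurd hj
        (Finset.filter_eq_empty_iff.mp h0 (Finset.mem_univ j)), by simp⟩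
    · exact ⟨_, h0, by simp, le_rfl⟩
  choose B hBne hBpos hBcard using hA
  let A : FaceTuple fun i => Fin (n i + 1) := ⟨B, hBne⟩
  have hAk : A.rank ≤ k := (Finset.sum_le_sum fun i _ => hBcard i).trans hz
  obtain ⟨x, hx, hxΦ⟩ := exists_mem_forall_mem_imp_subset (e A).2.subset ((e A).2.convex hQ)
    (e A).2.1 Φ hΦ Finset.univ
  have hxQ : x ∈ Q := (e A).2.subset hx
  obtain ⟨τ, -, hτ, hlast⟩ := hQc.exists_last_mem_ray hxQ hz0
  have hfx : f (x + τ • z) = f x := by rw [map_add, map_smul, hfz, smul_zero, add_zero]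
  obtain ⟨l, hl, hlpos⟩ : ∃ l, a l (x + τ • z) = h l ∧ 0 < a l z := by
    by_contra! hcon
    obtain ⟨ε, hε, hmemQ⟩ := hQ.exists_add_smul_mem hQc hle hfaces hp hp' hτ hzQ hcon
    refine hlast ε hε ?_
    rwa [add_smul, ← add_assoc]
  have hx'Φ : x + τ • z ∈ Φ l := (hmem l _).mpr ⟨hτ, hl⟩
  have hx'A := mem_face_of_map_eq s e hAk hx hτ hfx
  obtain ⟨A', hA'⟩ := e.surjective ⟨_, (e A).2.inter (hΦ l) ⟨_, hx'A, hx'Φ⟩⟩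
  have hA'eq : (e A' : Set (Fin N → ℝ)) = ↑(e A) ∩ Φ l := congrArg Subtype.val hA'
  have hA'A : A' ≤ A := (hsub _ _).mp (hA'eq.trans_subset inter_subset_left)
  have hxA' := mem_face_of_map_eq s e ((FaceTuple.rank_mono hA'A).trans hAk)
    (hA'eq.ge ⟨hx'A, hx'Φ⟩) hxQ hfx.symm
  exact (hsubΦ A l).mp (hxΦ l (Finset.mem_univ l) (hA'eq.le hxA').2) (hBpos _ _ hlpos)
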